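/- arXiv:1705.06727 — 4 statements merged into one kernel-verified Lean document; each statement's English description precedes it below -/
import Mathlib

section
/- Let g be a finite-dimensional real Lie algebra and let S be a family of derivations of g such that any two derivations in S commute and each derivation in S is a semisimple linear endomorphism of g. Then there exists a Levi subalgebra l of g (i.e., a semisimple Lie subalgebra l with g = l ⊕ r as vector spaces, where r is the radical of g) such that δ(l) ⊆ l for every δ ∈ S. -/
/-- `l` is a Levi subalgebra of `g`: a semisimple Lie subalgebra that is a vector-space
complement of the radical of `g`. -/
def IsLeviSubalgebra (g : Type*) [LieRing g] [LieAlgebra ℝ g]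
    (l : LieSubalgebra ℝ g) : Prop :=
  LieAlgebra.IsSemisimple ℝ l ∧
    IsCompl l.toSubmodule (LieAlgebra.radical ℝ g).toSubmodule

/-- A Lie algebra with nondegenerate Killing form is perfect. -/
theorem LieAlgebra.IsKilling.lie_top_top_eq_top {K L : Type*} [Field K] [LieRing L] [LieAlgebra K L]
    [FiniteDimensional K L] [LieAlgebra.IsKilling K L] :
    ⁅(⊤ : LieIdeal K L), (⊤ : LieIdeal K L)⁆ = ⊤ := by
  set I : LieIdeal K L := ⁅(⊤ : LieIdeal K L), (⊤ : LieIdeal K L)⁆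
  have h := LieIdeal.isCompl_killingCompl I
  have hab : LieIdeal.killingCompl K L I = ⊥ := by
    suffices IsLieAbelian (LieIdeal.killingCompl K L I) from
      LieAlgebra.IsKilling.ideal_eq_bot_of_isLieAbelian _
    refine (LieAlgebra.abelian_iff_derived_one_eq_bot _).mpr ?_
    refine eq_bot_iff.mpr (le_trans (le_inf ?_ ?_) h.inf_eq_bot.le)
    · exact LieSubmodule.mono_lie le_top le_top
    · exact LieAlgebra.derivedSeriesOfIdeal_le_self _ _
  have := h.sup_eq_top
  rwa [hab, sup_bot_eq] at this

/-- The Casimir operator of the trace form of a module: it commutes with the action, it takes values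
in the span of the brackets, and its trace vanishes only if the trace form does. -/
theorem LieModule.exists_casimir {K L V : Type*} [Field K] [CharZero K] [LieRing L] [LieAlgebra K L]
    [FiniteDimensional K L] [LieAlgebra.IsKilling K L] [AddCommGroup V] [Module K V]
    [FiniteDimensional K V] [LieRingModule L V] [LieModule K L V] :
    ∃ c : Module.End K V, (∀ (x : L) v, c ⁅x, v⁆ = ⁅x, c v⁆) ∧
      (∀ l : V →ₗ[K] K, (∀ (x : L) v, l ⁅x, v⁆ = 0) → ∀ v, l (c v) = 0) ∧
      (LinearMap.trace K V c = 0 → traceForm K L V = 0) := by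
  let B := traceForm K L V
  have hinv (x y z : L) : B ⁅x, y⁆ z = - B y ⁅x, z⁆ := by
    rw [← lie_skew, map_neg, LinearMap.neg_apply, traceForm_apply_lie_apply]
  let I : LieIdeal K L :=
    { LinearMap.ker B with
      lie_mem := by
        intro x y hy
        refine LinearMap.mem_ker.mpr (LinearMap.ext fun z ↦ ?_)
        rw [hinv, show B y = 0 from hy, LinearMap.zero_apply, neg_zero, LinearMap.zero_apply] }
  have hI (y : L) : y ∈ I ↔ B y = 0 := Iff.rfl
  let J := LieIdeal.killingCompl K L I
  have hIJ : IsCompl I J := LieIdeal.isCompl_killingCompl I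
  let BJ : LinearMap.BilinForm K J := LinearMap.BilinForm.restrict B J.toSubmodule
  have hBJ (x y : J) : BJ x y = B x y := rfl
  have hsymm : BJ.IsSymm := ⟨fun x y ↦ traceForm_comm K L V x y⟩
  have hdec (x : L) : ∃ y ∈ I, ∃ z ∈ J, y + z = x :=
    (LieSubmodule.mem_sup _ _ _).mp (hIJ.sup_eq_top ▸ LieSubmodule.mem_top x)
  have hnd : BJ.Nondegenerate := by
    refine LinearMap.BilinForm.Nondegenerate.ofSeparatingLeft fun y hy ↦ ?_
    have hyI : (y : L) ∈ I := by
      refine (hI _).mpr (LinearMap.ext fun x ↦ ?_)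
      obtain ⟨u, hu, z, hz, rfl⟩ := hdec x
      rw [map_add, traceForm_comm K L V _ u, (hI u).mp hu, LinearMap.zero_apply,
        LinearMap.zero_apply, zero_add]
      exact hy ⟨z, hz⟩
    have hy0 : (y : L) ∈ I ⊓ J := ⟨hyI, y.2⟩
    rw [hIJ.inf_eq_bot] at hy0
    exact Subtype.ext ((LieSubmodule.mem_bot (y : L)).mp hy0)
  let b := Module.finBasis K J
  let b' := BJ.dualBasis hnd b
  have hb (x : J) : x = ∑ i, BJ x (b' i) • b i := by
    conv_lhs => rw [← b.sum_repr x]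
    refine Finset.sum_congr rfl fun i _ ↦ ?_
    rw [← BJ.dualBasis_repr_apply hnd b' x i, BJ.dualBasis_dualBasis hnd hsymm]
  have hb' (x : J) : x = ∑ i, BJ x (b i) • b' i := by
    conv_lhs => rw [← b'.sum_repr x]
    simp only [b', BJ.dualBasis_repr_apply hnd b x]
  let φ : J →ₗ[K] V →ₗ[K] V := LinearMap.mk₂ K (fun y v ↦ ⁅(y : L), v⁆)
    (fun _ _ _ ↦ add_lie _ _ _) (fun _ _ _ ↦ smul_lie _ _ _) (fun _ _ _ ↦ lie_add _ _ _)
    (fun _ _ _ ↦ lie_smul _ _ _)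
  have hφ (y : J) (v : V) : φ y v = ⁅(y : L), v⁆ := rfl
  have hφx (x : L) (y : J) (v : V) : ⁅x, φ y v⁆ = φ ⁅x, y⁆ v + φ y ⁅x, v⁆ := by
    rw [hφ, hφ, hφ, LieSubmodule.coe_bracket, lie_lie, sub_add_cancel]
  refine ⟨∑ i, φ (b i) * φ (b' i), fun x v ↦ ?_, fun l hl v ↦ ?_, fun h ↦ ?_⟩
  · simp only [LinearMap.sum_apply, Module.End.mul_apply, lie_sum, hφx]
    have key : ∑ i, φ ⁅x, b i⁆ (φ (b' i) v) + ∑ i, φ (b i) (φ ⁅x, b' i⁆ v) = 0 := by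
      have h1 (i) : φ ⁅x, b i⁆ (φ (b' i) v)
          = ∑ j, BJ ⁅x, b i⁆ (b' j) • φ (b j) (φ (b' i) v) := by
        conv_lhs => rw [hb ⁅x, b i⁆]
        simp
      have h2 (i) : φ (b i) (φ ⁅x, b' i⁆ v)
          = ∑ j, BJ ⁅x, b' i⁆ (b j) • φ (b i) (φ (b' j) v) := by
        conv_lhs => rw [hb' ⁅x, b' i⁆]
        simp
      simp only [h1, h2]
      rw [Finset.sum_comm, ← Finset.sum_add_distrib]
      refine Finset.sum_eq_zero fun i _ ↦ ?_
      rw [← Finset.sum_add_distrib]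
      refine Finset.sum_eq_zero fun j _ ↦ ?_
      have : BJ ⁅x, b' i⁆ (b j) = - BJ ⁅x, b j⁆ (b' i) := by
        rw [hBJ, LieSubmodule.coe_bracket, hinv, hBJ]
        exact congrArg _ (traceForm_comm K L V _ _)
      rw [this, neg_smul, add_neg_cancel]
    simp only [map_add, Finset.sum_add_distrib]
    rw [← add_assoc, key, zero_add]
  · rw [LinearMap.sum_apply, map_sum]
    exact Finset.sum_eq_zero fun i _ ↦ hl _ _
  · have ht : LinearMap.trace K V (∑ i, φ (b i) * φ (b' i)) = (Module.finrank K J : K) := by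
      rw [map_sum]
      have htr (i) : LinearMap.trace K V (φ (b i) * φ (b' i)) = 1 := by
        have := BJ.apply_dualBasis_right hnd hsymm b i i
        rw [if_pos rfl] at this
        exact this
      simp [htr]
    rw [h, eq_comm, Nat.cast_eq_zero] at ht
    have hJ : J = ⊥ := by
      rw [← LieSubmodule.toSubmodule_eq_bot]
      exact Submodule.finrank_eq_zero.mp ht
    refine LinearMap.ext fun x ↦ ?_
    have : I = ⊤ := by simpa [hJ] using hIJ.sup_eq_top
    exact (hI x).mp (this ▸ LieSubmodule.mem_top x)

/-- A module with zero trace form over a Lie algebra with nondegenerate Killing form is trivial. -/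
theorem LieModule.isTrivial_of_traceForm_eq_zero {K L V : Type*} [Field K] [CharZero K]
    [LieRing L] [LieAlgebra K L] [FiniteDimensional K L] [LieAlgebra.IsKilling K L]
    [AddCommGroup V] [Module K V] [FiniteDimensional K V] [LieRingModule L V] [LieModule K L V]
    (h : traceForm K L V = 0) (x : L) (v : V) : ⁅x, v⁆ = 0 := by
  have hnil := isNilpotent_derivedSeries_of_traceForm_eq_zero h
  have hperf : LieAlgebra.derivedSeries K L 1 = ⊤ := LieAlgebra.IsKilling.lie_top_top_eq_top
  have hnil' : IsNilpotent L V := by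
    rw [isNilpotent_iff_forall' (R := K)]
    intro x
    exact isNilpotent_toEnd_of_isNilpotent K (LieAlgebra.derivedSeries K L 1) V
      ⟨x, hperf ▸ LieSubmodule.mem_top x⟩
  obtain ⟨k, hk⟩ := IsNilpotent.nilpotent K L V
  have key (j : ℕ) : ∀ (x : L) (v : V), ⁅x, v⁆ ∈ lowerCentralSeries K L V j := by
    induction j with
    | zero => simp
    | succ j ih =>
      intro x v
      have hx : x ∈ (⁅(⊤ : LieIdeal K L), (⊤ : LieIdeal K L)⁆).toSubmodule := by
        rw [LieAlgebra.IsKilling.lie_top_top_eq_top]; trivial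
      rw [LieSubmodule.lieIdeal_oper_eq_linear_span'] at hx
      induction hx using Submodule.span_induction with
      | mem x hx =>
        obtain ⟨y, -, z, -, rfl⟩ := hx
        rw [lie_lie, lowerCentralSeries_succ]
        exact sub_mem (LieSubmodule.lie_mem_lie (LieSubmodule.mem_top _) (ih _ _))
          (LieSubmodule.lie_mem_lie (LieSubmodule.mem_top _) (ih _ _))
      | zero => rw [zero_lie]; exact zero_mem _
      | add y z _ _ hy hz => rw [add_lie]; exact add_mem hy hz
      | smul a y _ hy => rw [smul_lie]; exact SMulMemClass.smul_mem a hy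
  have := key k x v
  rwa [hk, LieSubmodule.mem_bot] at this

/-- An instance of complete reducibility: a nonzero invariant linear form on a module over a Lie
algebra with nondegenerate Killing form does not vanish on the invariants. -/
theorem LieModule.exists_invariant_of_isKilling {K L : Type*} [Field K] [CharZero K] [LieRing L]
    [LieAlgebra K L] [FiniteDimensional K L] [LieAlgebra.IsKilling K L] (n : ℕ)
    (V : Type*) [AddCommGroup V] [Module K V]
    [FiniteDimensional K V] [LieRingModule L V] [LieModule K L V] (hn : Module.finrank K V = n)
    (l : V →ₗ[K] K) (hl : ∀ (x : L) v, l ⁅x, v⁆ = 0) (hne : l ≠ 0) :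
    ∃ v, l v ≠ 0 ∧ ∀ x : L, ⁅x, v⁆ = 0 := by
  induction n using Nat.strong_induction_on generalizing V with
  | _ n ih =>
  obtain ⟨c, hc, hcl, htr⟩ := exists_casimir (K := K) (L := L) (V := V)
  obtain ⟨k, hk, hcompl⟩ :=
    ((Filter.eventually_ge_atTop 1).and c.eventually_isCompl_ker_pow_range_pow).exists
  by_cases htop : LinearMap.ker (c ^ k) = ⊤
  · have hnil : _root_.IsNilpotent c := ⟨k, LinearMap.ker_eq_top.mp htop⟩
    have := htr (LinearMap.isNilpotent_trace_of_isNilpotent hnil).eq_zero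
    obtain ⟨v, hv⟩ := DFunLike.ne_iff.mp hne
    exact ⟨v, hv, fun x ↦ isTrivial_of_traceForm_eq_zero this x v⟩
  have hck (x : L) (j : ℕ) (v : V) : (c ^ j) ⁅x, v⁆ = ⁅x, (c ^ j) v⁆ := by
    induction j with
    | zero => simp
    | succ j ihj => rw [pow_succ', Module.End.mul_apply, ihj, hc, Module.End.mul_apply]
  let N : LieSubmodule K L V :=
    { LinearMap.ker (c ^ k) with
      lie_mem := by
        intro x v hv
        refine LinearMap.mem_ker.mpr ?_
        rw [hck, show (c ^ k) v = 0 from hv, lie_zero] }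
  have hlN : l ∘ₗ N.toSubmodule.subtype ≠ 0 := by
    obtain ⟨v, hv⟩ := DFunLike.ne_iff.mp hne
    obtain ⟨w, hw, _, ⟨z, rfl⟩, hwz⟩ :=
      Submodule.mem_sup.mp (hcompl.sup_eq_top ▸ Submodule.mem_top (x := v))
    refine DFunLike.ne_iff.mpr ⟨⟨w, hw⟩, ?_⟩
    have h0 : l ((c ^ k) z) = 0 := by
      obtain ⟨k, rfl⟩ := Nat.exists_eq_add_of_le' hk
      rw [pow_succ', Module.End.mul_apply, hcl l hl]
    rw [← hwz, map_add, h0, add_zero] at hv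
    exact hv
  obtain ⟨v, hv, hv'⟩ := ih _ (hn ▸ Submodule.finrank_lt htop) N rfl
    (l ∘ₗ N.toSubmodule.subtype) (fun x v ↦ hl x v) hlN
  exact ⟨v, hv, fun x ↦ congrArg Subtype.val (hv' x)⟩

theorem Polynomial.aeval_commutator {K A : Type*} [Field K] [Ring A] [Algebra K A]
    {T φ : A} (h : Commute T (T * φ - φ * T)) (p : Polynomial K) :
    aeval T p * φ - φ * aeval T p = aeval T (derivative p) * (T * φ - φ * T) := by
  induction p using Polynomial.induction_on' with
  | add p q hp hq =>
    simp only [map_add, add_mul, mul_add, ← hp, ← hq]; abel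
  | monomial n a =>
    have H (n : ℕ) : T ^ (n + 1) * φ - φ * T ^ (n + 1) =
        ((n + 1 : ℕ) : A) * (T ^ n * (T * φ - φ * T)) := by
      induction n with
      | zero => simp
      | succ n ih =>
        have e : T ^ (n + 1 + 1) * φ - φ * T ^ (n + 1 + 1)
            = T * (T ^ (n + 1) * φ - φ * T ^ (n + 1)) + (T * φ - φ * T) * T ^ (n + 1) := by
          rw [pow_succ' T (n + 1)]; noncomm_ring
        rw [e, ih, ← (h.pow_left (n + 1)).eq, ← mul_assoc T, ← (Nat.cast_commute (n + 1) T).eq,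
          mul_assoc, ← mul_assoc T, ← pow_succ', Nat.cast_succ (n + 1), add_mul, one_mul]
    rcases n with _ | n
    · simp [Algebra.commutes]
    · simp only [aeval_monomial, derivative_monomial, map_mul, map_natCast, mul_assoc,
        Nat.add_sub_cancel]
      rw [← H, mul_sub, ← mul_assoc φ, ← Algebra.commutes a φ, mul_assoc]

theorem Polynomial.Separable.commute_of_commute_commutator {K A : Type*} [Field K]
    [Ring A] [Algebra K A] {T φ : A} {p : Polynomial K} (hp : p.Separable) (hT : aeval T p = 0)
    (h : Commute T (T * φ - φ * T)) : T * φ - φ * T = 0 := by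
  obtain ⟨a, b, hab⟩ := hp
  have h1 := Polynomial.aeval_commutator h p
  have h2 := congrArg (aeval T) hab
  simp only [map_add, map_mul, hT, mul_zero, zero_add, map_one] at h2
  rw [hT, zero_mul, mul_zero, sub_zero] at h1
  rw [← one_mul (T * φ - φ * T), ← h2, mul_assoc, ← h1, mul_zero]

/-- A linear form on a subspace stable under commuting operators `D i` with
`ker (D i ^ 2) = ker (D i)`, which is nonzero but kills the images of the `D i`, does not vanish on
the common kernel. -/
theorem Submodule.exists_mem_forall_apply_eq_zero {K V ι : Type*} [Field K] [AddCommGroup V]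
    [Module K V] [FiniteDimensional K V] (D : ι → Module.End K V)
    (hcomm : ∀ i j, Commute (D i) (D j)) (hss : ∀ i v, D i (D i v) = 0 → D i v = 0)
    (l : V →ₗ[K] K) (E : Submodule K V) (hE : ∀ i, ∀ v ∈ E, D i v ∈ E)
    (hl : ∀ i, ∀ v ∈ E, l (D i v) = 0) (hne : ∃ v ∈ E, l v ≠ 0) :
    ∃ v ∈ E, l v ≠ 0 ∧ ∀ i, D i v = 0 := by
  induction hn : Module.finrank K E using Nat.strong_induction_on generalizing E with
  | _ n ih =>
  by_cases h0 : ∀ i, ∀ v ∈ E, D i v = 0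
  · obtain ⟨v, hv, hlv⟩ := hne
    exact ⟨v, hv, hlv, fun i ↦ h0 i v hv⟩
  push Not at h0
  obtain ⟨i, w, hw, hiw⟩ := h0
  have hlt : E ⊓ LinearMap.ker (D i) < E :=
    lt_of_le_of_ne inf_le_left fun h ↦ hiw (h.ge hw).2
  have hcompl : IsCompl (LinearMap.ker ((D i).restrict (hE i)))
      (LinearMap.range ((D i).restrict (hE i))) := by
    have hd : Disjoint (LinearMap.ker ((D i).restrict (hE i)))
        (LinearMap.range ((D i).restrict (hE i))) := by
      rw [Submodule.disjoint_def]
      rintro _ hx ⟨⟨z, hz⟩, rfl⟩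
      exact Subtype.ext (hss i z (congrArg Subtype.val (LinearMap.mem_ker.mp hx)))
    refine ⟨hd, codisjoint_iff.mpr (Submodule.eq_top_of_disjoint _ _ ?_ hd)⟩
    rw [add_comm, LinearMap.finrank_range_add_finrank_ker]
  obtain ⟨v, hv, hlv⟩ := hne
  obtain ⟨⟨x, hx⟩, hx', y, ⟨z, rfl⟩, hxy⟩ :=
    Submodule.mem_sup.mp (hcompl.sup_eq_top ▸ Submodule.mem_top (x := (⟨v, hv⟩ : E)))
  have hxy' : x + D i z = v := congrArg Subtype.val hxy
  have hx0 : D i x = 0 := congrArg Subtype.val (LinearMap.mem_ker.mp hx')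
  obtain ⟨u, hu, h⟩ := ih _ (hn ▸ Submodule.finrank_lt_finrank_of_lt hlt) (E ⊓ LinearMap.ker (D i))
    (fun j v hv ↦ ⟨hE j v hv.1, by
      have := LinearMap.congr_fun (hcomm i j).eq v
      simp only [Module.End.mul_apply] at this
      exact this.trans (by rw [LinearMap.mem_ker.mp hv.2, map_zero])⟩)
    (fun j v hv ↦ hl j v hv.1)
    ⟨x, ⟨hx, hx0⟩, by rwa [← hxy', map_add, hl i z z.2, add_zero] at hlv⟩ rfl
  exact ⟨u, hu.1, h⟩

/-- `LieModule.exists_invariant_of_isKilling` for modules on which `L` acts through a quotient. -/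
theorem LieModule.exists_invariant_of_surjective {K L S V : Type*} [Field K] [CharZero K]
    [LieRing L] [LieAlgebra K L] [LieRing S] [LieAlgebra K S] [FiniteDimensional K S]
    [LieAlgebra.IsKilling K S] [AddCommGroup V] [Module K V] [FiniteDimensional K V]
    [LieRingModule L V] [LieModule K L V] (f : L →ₗ⁅K⁆ S) (hf : Function.Surjective f)
    (htriv : ∀ x, f x = 0 → ∀ v : V, ⁅x, v⁆ = 0)
    (l : V →ₗ[K] K) (hl : ∀ (x : L) v, l ⁅x, v⁆ = 0) (hne : l ≠ 0) :
    ∃ v, l v ≠ 0 ∧ ∀ x : L, ⁅x, v⁆ = 0 := by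
  obtain ⟨σ, hσ⟩ := f.toLinearMap.exists_rightInverse_of_surjective (LinearMap.range_eq_top.mpr hf)
  have hσf (x : S) : f (σ x) = x := LinearMap.congr_fun hσ x
  have hact (x y : L) (h : f x = f y) (v : V) : ⁅x, v⁆ = ⁅y, v⁆ := by
    rw [← sub_eq_zero, ← sub_lie]
    exact htriv _ (by rw [map_sub, h, sub_self]) v
  let : LieRingModule S V :=
    { bracket := fun x v ↦ ⁅σ x, v⁆
      add_lie := fun x y v ↦ by
        rw [map_add, add_lie]
      lie_add := fun x v w ↦ lie_add (σ x) v w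
      leibniz_lie := fun x y v ↦ by
        change ⁅σ x, ⁅σ y, v⁆⁆ = ⁅σ ⁅x, y⁆, v⁆ + ⁅σ y, ⁅σ x, v⁆⁆
        rw [leibniz_lie, hact ⁅σ x, σ y⁆ (σ ⁅x, y⁆) (by simp [hσf])] }
  let : LieModule K S V :=
    { smul_lie := fun t x v ↦ by
        change ⁅σ (t • x), v⁆ = t • ⁅σ x, v⁆
        rw [map_smul, smul_lie]
      lie_smul := fun t x v ↦ lie_smul t (σ x) v }
  obtain ⟨v, hv, hv'⟩ := exists_invariant_of_isKilling (L := S) _ V rfl l (fun x v ↦ hl (σ x) v) hne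
  exact ⟨v, hv, fun x ↦ (hact x (σ (f x)) (hσf _).symm v).trans (hv' (f x))⟩

namespace LieHom

variable {K L S : Type*} [Field K] [LieRing L] [LieAlgebra K L] [LieRing S] [LieAlgebra K S]

/-- The endomorphisms of `L` with values in the kernel of `f` that are scalar on this kernel. -/
def scalarOnKer (f : L →ₗ⁅K⁆ S) : LieSubmodule K L (L →ₗ[K] L) where
  carrier := {φ | (∀ y, f (φ y) = 0) ∧ ∃ t : K, ∀ y, f y = 0 → φ y = t • y}
  zero_mem' := ⟨fun y ↦ by simp, 0, fun y _ ↦ by simp⟩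
  add_mem' := by
    rintro φ ψ ⟨h1, t, ht⟩ ⟨h2, u, hu⟩
    refine ⟨fun y ↦ by simp [h1, h2], t + u, fun y hy ↦ ?_⟩
    rw [LinearMap.add_apply, ht y hy, hu y hy, add_smul]
  smul_mem' := by
    rintro a φ ⟨h1, t, ht⟩
    refine ⟨fun y ↦ by simp [h1], a * t, fun y hy ↦ ?_⟩
    rw [LinearMap.smul_apply, ht y hy, mul_smul]
  lie_mem := by
    rintro x φ ⟨h1, t, ht⟩
    refine ⟨fun y ↦ by simp [h1], 0, fun y hy ↦ ?_⟩
    rw [LieHom.lie_apply, ht y hy, ht _ (by simp [hy]), lie_smul, sub_self, zero_smul]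

/-- The inner derivations of `L` defined by elements of the kernel of `f`. -/
def adKer (f : L →ₗ⁅K⁆ S) : LieSubmodule K L (L →ₗ[K] L) where
  carrier := {φ | ∃ y, f y = 0 ∧ ∀ z, φ z = ⁅y, z⁆}
  zero_mem' := ⟨0, by simp, fun z ↦ by simp⟩
  add_mem' := by
    rintro φ ψ ⟨x, h1, hx⟩ ⟨y, h2, hy⟩
    exact ⟨x + y, by simp [h1, h2], fun z ↦ by rw [LinearMap.add_apply, hx, hy, add_lie]⟩
  smul_mem' := by
    rintro a φ ⟨x, h1, hx⟩
    exact ⟨a • x, by simp [h1], fun z ↦ by rw [LinearMap.smul_apply, hx, smul_lie]⟩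
  lie_mem := by
    rintro x φ ⟨y, h, hy⟩
    exact ⟨⁅x, y⁆, by simp [h], fun z ↦ by rw [LieHom.lie_apply, hy, hy, lie_lie]⟩

variable [FiniteDimensional K L] [FiniteDimensional K S] [CharZero K] [LieAlgebra.IsKilling K S]

/-- In an extension of a Lie algebra with nondegenerate Killing form by an abelian kernel, some
endomorphism with values in the kernel is a nonzero scalar on the kernel and commutes with the
adjoint action modulo inner derivations from the kernel. -/
theorem exists_mem_scalarOnKer (f : L →ₗ⁅K⁆ S) (hf : Function.Surjective f)
    (hab : ∀ x y, f x = 0 → f y = 0 → ⁅x, y⁆ = 0) {y₀ : L} (hy₀ : f y₀ = 0) (e : L →ₗ[K] K)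
    (he : e y₀ ≠ 0) :
    ∃ φ ∈ f.scalarOnKer, e (φ y₀) ≠ 0 ∧ ∀ x : L, ⁅x, φ⁆ ∈ f.adKer := by
  let M := f.scalarOnKer
  let P : LieSubmodule K L M := f.adKer.comap M.incl
  let l₀ : M →ₗ[K] K := e ∘ₗ LinearMap.applyₗ y₀ ∘ₗ M.toSubmodule.subtype
  have hl₀ (φ : M) : l₀ φ = e (φ.1 y₀) := rfl
  have hP : P.toSubmodule ≤ LinearMap.ker l₀ := by
    rintro φ ⟨y, hy, hφ⟩
    refine LinearMap.mem_ker.mpr ?_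
    rw [hl₀]
    exact (congrArg e ((hφ y₀).trans (hab y y₀ hy hy₀))).trans (map_zero e)
  let l : (M ⧸ P) →ₗ[K] K := P.toSubmodule.liftQ l₀ hP
  have hl (φ : M) : l (LieSubmodule.Quotient.mk φ) = e (φ.1 y₀) := rfl
  have hmk (x : L) (φ : M) :
      ⁅x, (LieSubmodule.Quotient.mk φ : M ⧸ P)⁆ = LieSubmodule.Quotient.mk ⁅x, φ⁆ := rfl
  have h1 (x : L) (hx : f x = 0) (v : M ⧸ P) : ⁅x, v⁆ = 0 := by
    obtain ⟨φ, rfl⟩ := LieSubmodule.Quotient.surjective_mk' P v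
    refine LieSubmodule.Quotient.mk_eq_zero'.mpr ?_
    obtain ⟨h, t, ht⟩ := φ.2
    refine ⟨-(t • x), by simp [hx], fun z ↦ ?_⟩
    change ⁅x, φ.1 z⁆ - φ.1 ⁅x, z⁆ = _
    rw [hab x _ hx (h z), ht _ (by simp [hx]), zero_sub, neg_lie, smul_lie]
  have h2 (x : L) (v : M ⧸ P) : l ⁅x, v⁆ = 0 := by
    obtain ⟨φ, rfl⟩ := LieSubmodule.Quotient.surjective_mk' P v
    obtain ⟨h, t, ht⟩ := φ.2
    change e (⁅x, φ.1 y₀⁆ - φ.1 ⁅x, y₀⁆) = 0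
    rw [ht _ hy₀, ht _ (by simp [hy₀]), lie_smul, sub_self, map_zero]
  have h3 : l ≠ 0 := by
    obtain ⟨p, hp⟩ := (LinearMap.ker f.toLinearMap).subtype.exists_leftInverse_of_injective
      (Submodule.ker_subtype _)
    have hp' (y : L) (hy : f y = 0) : (p y : L) = y :=
      congrArg Subtype.val (LinearMap.congr_fun hp ⟨y, hy⟩)
    let φ : M := ⟨(LinearMap.ker f.toLinearMap).subtype ∘ₗ p, fun y ↦ (p y).2, 1, fun y hy ↦ by
      rw [one_smul]; exact hp' y hy⟩
    intro h0
    refine he ?_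
    have := hl φ
    rw [h0, LinearMap.zero_apply] at this
    exact (this.trans (congrArg e (hp' y₀ hy₀))).symm
  obtain ⟨v, hv, hv'⟩ := LieModule.exists_invariant_of_surjective f hf h1 l h2 h3
  obtain ⟨φ, rfl⟩ := LieSubmodule.Quotient.surjective_mk' P v
  exact ⟨φ.1, φ.2, hv, fun x ↦
    (LieSubmodule.Quotient.mk_eq_zero' (N := P) (m := ⁅x, φ⁆)).mp (hv' x)⟩

variable {ι : Type*}

/-- The endomorphism of `LieHom.exists_mem_scalarOnKer` can be chosen to commute with a given
toral family of derivations. -/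
theorem exists_commuting_mem_scalarOnKer (f : L →ₗ⁅K⁆ S) (hf : Function.Surjective f)
    (hab : ∀ x y, f x = 0 → f y = 0 → ⁅x, y⁆ = 0) {y₀ : L} (hy₀ : f y₀ = 0) (hy₀' : y₀ ≠ 0)
    (D : ι → Module.End K L) (hD : ∀ i x y, D i ⁅x, y⁆ = ⁅D i x, y⁆ + ⁅x, D i y⁆)
    (hcomm : ∀ i j, Commute (D i) (D j))
    (hsep : ∀ i, ∃ p : Polynomial K, p.Separable ∧ Polynomial.aeval (D i) p = 0)
    (hker : ∀ i x, f x = 0 → f (D i x) = 0) :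
    ∃ φ : L →ₗ[K] L, (∀ y, f (φ y) = 0) ∧ (∃ t : K, t ≠ 0 ∧ ∀ y, f y = 0 → φ y = t • y) ∧
      (∀ x : L, ⁅x, φ⁆ ∈ f.adKer) ∧ ∀ i x, φ (D i x) = D i (φ x) := by
  obtain ⟨e, he⟩ : ∃ e : Module.Dual K L, e y₀ ≠ 0 := by
    by_contra! h
    exact hy₀' ((Module.forall_dual_apply_eq_zero_iff K y₀).mp h)
  let ad' (i : ι) : Module.End K (Module.End K L) :=
    LinearMap.mulLeft K (D i) - LinearMap.mulRight K (D i)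
  have had' (i : ι) (φ : Module.End K L) : ad' i φ = D i * φ - φ * D i := rfl
  have had (i : ι) (φ : Module.End K L) (x : L) : ad' i φ x = D i (φ x) - φ (D i x) := rfl
  let E : Submodule K (Module.End K L) :=
    { carrier := {φ | φ ∈ f.scalarOnKer ∧ ∀ x : L, ⁅x, (φ : L →ₗ[K] L)⁆ ∈ f.adKer}
      zero_mem' := ⟨zero_mem _, fun x ↦ by rw [lie_zero]; exact zero_mem _⟩
      add_mem' := fun {φ ψ} h h' ↦ ⟨add_mem h.1 h'.1, fun x ↦ by
        rw [lie_add]; exact add_mem (h.2 x) (h'.2 x)⟩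
      smul_mem' := fun a φ h ↦ ⟨SMulMemClass.smul_mem a h.1, fun x ↦ by
        rw [lie_smul]; exact SMulMemClass.smul_mem a (h.2 x)⟩ }
  have hE (φ : Module.End K L) : φ ∈ E ↔
    φ ∈ f.scalarOnKer ∧ ∀ x : L, ⁅x, (φ : L →ₗ[K] L)⁆ ∈ f.adKer := Iff.rfl
  have hcomm' (i j) : Commute (ad' i) (ad' j) := by
    refine LinearMap.ext fun φ ↦ ?_
    have := (hcomm i j).eq
    simp only [Module.End.mul_apply, had', mul_sub, sub_mul, mul_assoc, this]
    simp only [← mul_assoc, this]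
    abel
  have hss (i φ) (h : ad' i (ad' i φ) = 0) : ad' i φ = 0 := by
    obtain ⟨p, hp, hp0⟩ := hsep i
    exact hp.commute_of_commute_commutator hp0 (sub_eq_zero.mp h)
  have hstab : ∀ i, ∀ φ ∈ E, ad' i φ ∈ E := by
    rintro i φ ⟨⟨h1, t, ht⟩, h2⟩
    refine ⟨⟨fun y ↦ ?_, 0, fun y hy ↦ ?_⟩, fun x ↦ ?_⟩
    · rw [had, map_sub, h1, hker i _ (h1 y), sub_zero]
    · rw [had, ht y hy, ht _ (hker i y hy), map_smul, sub_self, zero_smul]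
    · obtain ⟨y, hy, hxy⟩ := h2 x
      obtain ⟨z, hz, hxz⟩ := h2 (D i x)
      refine ⟨D i y - z, by rw [map_sub, hker i y hy, hz, sub_zero], fun w ↦ ?_⟩
      have e1 := hxy w
      have e2 := hxy (D i w)
      have e3 := hxz w
      simp only [LieHom.lie_apply] at e1 e2 e3 ⊢
      rw [sub_lie, ← e3, ← sub_eq_iff_eq_add.mpr (hD i y w), ← e1, ← e2]
      simp only [had, map_sub, lie_sub, hD, map_add]
      abel
  have hzero : ∀ i, ∀ φ ∈ E, (e ∘ₗ LinearMap.applyₗ y₀) (ad' i φ) = 0 := by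
    rintro i φ ⟨⟨h1, t, ht⟩, h2⟩
    change e (D i (φ y₀) - φ (D i y₀)) = 0
    rw [ht y₀ hy₀, ht _ (hker i y₀ hy₀), map_smul, sub_self, map_zero]
  obtain ⟨φ, ⟨⟨h1, t, ht⟩, h2⟩, h3, h4⟩ :=
    Submodule.exists_mem_forall_apply_eq_zero ad' hcomm' hss (e ∘ₗ LinearMap.applyₗ y₀) E hstab
      hzero
      (f.exists_mem_scalarOnKer hf hab hy₀ e he |>.imp fun φ h ↦ ⟨⟨h.1, h.2.2⟩, h.2.1⟩)
  refine ⟨φ, h1, ⟨t, ?_, ht⟩, h2, fun i x ↦ ?_⟩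
  · rintro rfl
    refine h3 ?_
    change e (φ y₀) = 0
    rw [ht y₀ hy₀, zero_smul, map_zero]
  · exact (sub_eq_zero.mp (LinearMap.congr_fun (h4 i) x)).symm

/-- An extension of a Lie algebra with nondegenerate Killing form by a nonzero abelian kernel has a
proper invariant subalgebra that surjects onto the quotient. -/
theorem exists_invariant_subalgebra_ne_top (f : L →ₗ⁅K⁆ S) (hf : Function.Surjective f)
    (hab : ∀ x y, f x = 0 → f y = 0 → ⁅x, y⁆ = 0) {y₀ : L} (hy₀ : f y₀ = 0) (hy₀' : y₀ ≠ 0)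
    (D : ι → Module.End K L) (hD : ∀ i x y, D i ⁅x, y⁆ = ⁅D i x, y⁆ + ⁅x, D i y⁆)
    (hcomm : ∀ i j, Commute (D i) (D j))
    (hsep : ∀ i, ∃ p : Polynomial K, p.Separable ∧ Polynomial.aeval (D i) p = 0)
    (hker : ∀ i x, f x = 0 → f (D i x) = 0) :
    ∃ l : LieSubalgebra K L, l ≠ ⊤ ∧ (∀ i, ∀ x ∈ l, D i x ∈ l) ∧ ∀ x, ∃ y ∈ l, f y = f x := by
  obtain ⟨φ, h1, ⟨t, ht0, ht⟩, h2, h3⟩ :=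
    f.exists_commuting_mem_scalarOnKer hf hab hy₀ hy₀' D hD hcomm hsep hker
  by_cases htriv : ∀ x y : L, φ ⁅x, y⁆ = ⁅x, φ y⁆
  · let l : LieSubalgebra K L :=
      { LinearMap.ker φ with
        lie_mem' := fun {x y} _ hy ↦ LinearMap.mem_ker.mpr (by
          rw [htriv, show φ y = 0 from hy, lie_zero]) }
    have hl (x : L) : x ∈ l ↔ φ x = 0 := Iff.rfl
    refine ⟨l, fun h ↦ ?_, fun i x hx ↦ ?_, fun x ↦ ⟨x - t⁻¹ • φ x, ?_, ?_⟩⟩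
    · have := (hl y₀).mp (h ▸ LieSubalgebra.mem_top y₀)
      rw [ht y₀ hy₀] at this
      exact (smul_ne_zero ht0 hy₀') this
    · rw [hl, h3, (hl x).mp hx, map_zero]
    · rw [hl, map_sub, map_smul, ht _ (h1 x), inv_smul_smul₀ ht0, sub_self]
    · rw [map_sub, map_smul, h1, smul_zero, sub_zero]
  · let l : LieSubalgebra K L :=
      { carrier := {x | ∀ y, φ ⁅x, y⁆ = ⁅x, φ y⁆}
        zero_mem' := fun y ↦ by simp
        add_mem' := fun {x x'} hx hx' y ↦ by rw [add_lie, add_lie, map_add, hx, hx']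
        smul_mem' := fun a x hx y ↦ by rw [smul_lie, smul_lie, map_smul, hx]
        lie_mem' := fun {x x'} hx hx' y ↦ by
          simp only [lie_lie, map_sub, hx _, hx' _] }
    have hl (x : L) : x ∈ l ↔ ∀ y, φ ⁅x, y⁆ = ⁅x, φ y⁆ := Iff.rfl
    refine ⟨l, fun h ↦ htriv fun x ↦ (hl x).mp (h ▸ LieSubalgebra.mem_top x),
      fun i x hx ↦ (hl _).mpr fun y ↦ ?_, fun x ↦ ?_⟩
    · have := congrArg (D i) (hx y)
      rw [hD, ← h3, hD, map_add, ← h3, hx (D i y)] at this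
      exact add_right_cancel this
    · obtain ⟨z, hz, hxz⟩ := h2 x
      refine ⟨x + t⁻¹ • z, fun y ↦ ?_, by rw [map_add, map_smul, hz, smul_zero, add_zero]⟩
      have h4 : ⁅x, φ y⁆ - φ ⁅x, y⁆ = ⁅z, y⁆ := hxz y
      have h5 : φ ⁅z, y⁆ = t • ⁅z, y⁆ := ht _ (by simp [hz])
      rw [add_lie, add_lie, smul_lie, smul_lie, map_add, map_smul, h5, inv_smul_smul₀ ht0,
        hab z _ hz (h1 y), smul_zero, add_zero, ← h4, add_sub_cancel]

end LieHom

/-- A family of commuting derivations of a Lie algebra, each annihilated by a separable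
polynomial. -/
structure LieAlgebra.IsToralFamily {K L ι : Type*} [Field K] [LieRing L] [LieAlgebra K L]
    (D : ι → Module.End K L) : Prop where
  apply_lie (i : ι) (x y : L) : D i ⁅x, y⁆ = ⁅D i x, y⁆ + ⁅x, D i y⁆
  commute (i j : ι) : Commute (D i) (D j)
  exists_separable (i : ι) : ∃ p : Polynomial K, p.Separable ∧ Polynomial.aeval (D i) p = 0

theorem LinearMap.map_aeval_apply {K V W : Type*} [Field K] [AddCommGroup V] [Module K V]
    [AddCommGroup W] [Module K W] (f : V →ₗ[K] W) {A : Module.End K V} {B : Module.End K W}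
    (h : ∀ x, f (A x) = B (f x)) (p : Polynomial K) (x : V) :
    f (Polynomial.aeval A p x) = Polynomial.aeval B p (f x) := by
  induction p using Polynomial.induction_on' with
  | add p q hp hq => simp [hp, hq]
  | monomial n a =>
    have H (n : ℕ) : f ((A ^ n) x) = (B ^ n) (f x) := by
      induction n with
      | zero => simp
      | succ n ih => rw [pow_succ', Module.End.mul_apply, h, ih, pow_succ', Module.End.mul_apply]
    simp [Polynomial.aeval_monomial, H]

namespace LieAlgebra.IsToralFamily

variable {K L L' ι : Type*} [Field K] [LieRing L] [LieAlgebra K L] [LieRing L'] [LieAlgebra K L']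
  {D : ι → Module.End K L} {D' : ι → Module.End K L'}

theorem of_surjective (hD : IsToralFamily D) (f : L →ₗ⁅K⁆ L') (hf : Function.Surjective f)
    (h : ∀ i x, f (D i x) = D' i (f x)) : IsToralFamily D' where
  apply_lie i x y := by
    obtain ⟨x, rfl⟩ := hf x
    obtain ⟨y, rfl⟩ := hf y
    rw [← LieHom.map_lie, ← h, hD.apply_lie, map_add, LieHom.map_lie, LieHom.map_lie, h, h]
  commute i j := LinearMap.ext fun x ↦ by
    obtain ⟨x, rfl⟩ := hf x
    have := LinearMap.congr_fun (hD.commute i j).eq x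
    simp only [Module.End.mul_apply] at this ⊢
    rw [← h, ← h, this, h, h]
  exists_separable i := by
    obtain ⟨p, hp, h0⟩ := hD.exists_separable i
    refine ⟨p, hp, LinearMap.ext fun x ↦ ?_⟩
    obtain ⟨x, rfl⟩ := hf x
    have := f.toLinearMap.map_aeval_apply (h i) p x
    rw [h0, LinearMap.zero_apply, map_zero] at this
    exact this.symm

theorem of_injective (hD' : IsToralFamily D') (f : L →ₗ⁅K⁆ L') (hf : Function.Injective f)
    (h : ∀ i x, f (D i x) = D' i (f x)) : IsToralFamily D where
  apply_lie i x y := hf <| by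
    rw [map_add, LieHom.map_lie, LieHom.map_lie, h, LieHom.map_lie, h, h, hD'.apply_lie]
  commute i j := LinearMap.ext fun x ↦ hf <| by
    have := LinearMap.congr_fun (hD'.commute i j).eq (f x)
    simp only [Module.End.mul_apply] at this ⊢
    rw [h, h, this, h, h]
  exists_separable i := by
    obtain ⟨p, hp, h0⟩ := hD'.exists_separable i
    refine ⟨p, hp, LinearMap.ext fun x ↦ hf ?_⟩
    refine (f.toLinearMap.map_aeval_apply (h i) p x).trans ?_
    rw [h0, LinearMap.zero_apply, LinearMap.zero_apply, map_zero]

end LieAlgebra.IsToralFamily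

section

variable {K L L' : Type*} [Field K] [LieRing L] [LieAlgebra K L] [LieRing L'] [LieAlgebra K L']

/-- The quotient map by a Lie ideal, as a morphism of Lie algebras. -/
def LieIdeal.quotientMk (I : LieIdeal K L) : L →ₗ⁅K⁆ L ⧸ I :=
  { LieSubmodule.Quotient.mk' I with
    map_lie' := fun {x y} ↦ LieSubmodule.Quotient.mk_bracket I x y }

theorem LieIdeal.quotientMk_surjective (I : LieIdeal K L) : Function.Surjective I.quotientMk :=
  LieSubmodule.Quotient.surjective_mk' I

theorem LieIdeal.quotientMk_eq_zero (I : LieIdeal K L) (x : L) : I.quotientMk x = 0 ↔ x ∈ I :=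
  LieSubmodule.Quotient.mk_eq_zero'

/-- An ideal mapped into a solvable ideal by a morphism with solvable kernel is solvable. -/
theorem LieIdeal.isSolvable_of_map (f : L →ₗ⁅K⁆ L') (hf : LieAlgebra.IsSolvable f.ker)
    (J : LieIdeal K L) (J' : LieIdeal K L') (hJ : ∀ x ∈ J, f x ∈ J')
    (hJ' : LieAlgebra.IsSolvable J') : LieAlgebra.IsSolvable J := by
  obtain ⟨k, hk⟩ := (LieAlgebra.isSolvable_iff K J').mp hJ'
  rw [LieIdeal.derivedSeries_eq_bot_iff] at hk
  have key (k : ℕ) : (LieAlgebra.derivedSeriesOfIdeal K L k J).map f ≤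
      LieAlgebra.derivedSeriesOfIdeal K L' k J' := by
    induction k with
    | zero => exact LieIdeal.map_le_iff_le_comap.mpr hJ
    | succ k ih =>
      rw [LieAlgebra.derivedSeriesOfIdeal_succ, LieAlgebra.derivedSeriesOfIdeal_succ]
      exact (LieIdeal.map_bracket_le f).trans (LieSubmodule.mono_lie ih ih)
  have hle : LieAlgebra.derivedSeriesOfIdeal K L k J ≤ f.ker := fun x hx ↦ by
    have := key k (LieIdeal.mem_map hx)
    rwa [hk, LieSubmodule.mem_bot] at this
  obtain ⟨l, hl⟩ := (LieAlgebra.isSolvable_iff K _).mp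
    (LieAlgebra.le_solvable_ideal_solvable hle hf)
  rw [LieIdeal.derivedSeries_eq_bot_iff, ← LieAlgebra.derivedSeriesOfIdeal_add] at hl
  exact LieAlgebra.IsSolvable.mk ((LieIdeal.derivedSeries_eq_bot_iff _ _).mpr hl)

/-- The kernel of the Killing form is stable under derivations. -/
theorem LieIdeal.apply_mem_killingCompl_top (D : Module.End K L)
    (hD : ∀ x y, D ⁅x, y⁆ = ⁅D x, y⁆ + ⁅x, D y⁆) {x : L} (hx : x ∈ LieIdeal.killingCompl K L ⊤) :
    D x ∈ LieIdeal.killingCompl K L ⊤ := by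
  rw [LieIdeal.mem_killingCompl] at hx ⊢
  intro y _
  have had (z : L) : LieAlgebra.ad K L (D z) = D * LieAlgebra.ad K L z - LieAlgebra.ad K L z * D :=
    LinearMap.ext fun w ↦ by
      simp [LieAlgebra.ad_apply, hD]
  have h0 := hx (D y) trivial
  change LinearMap.trace K L (LieAlgebra.ad K L _ * LieAlgebra.ad K L _) = 0 at h0 ⊢
  rw [had, sub_mul, map_sub, mul_assoc, LinearMap.trace_mul_comm] at h0
  rw [had, mul_sub, map_sub]
  simp only [mul_assoc] at h0 ⊢
  rw [sub_eq_zero.mp h0, sub_self]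

/-- The endomorphism induced on the quotient by an invariant Lie ideal. -/
def LieIdeal.quotientEnd (I : LieIdeal K L) (D : Module.End K L) (h : ∀ x ∈ I, D x ∈ I) :
    Module.End K (L ⧸ I) :=
  Submodule.mapQ I.toSubmodule I.toSubmodule D h

/-- The radical is stable under a toral family, and the Killing form of the quotient by the radical
is nondegenerate. -/
theorem LieAlgebra.IsToralFamily.radical_invariant_and_isKilling_quotient [CharZero K]
    [FiniteDimensional K L] {ι : Type*} {D : ι → Module.End K L} (hD : IsToralFamily D) :
    (∀ i, ∀ x ∈ LieAlgebra.radical K L, D i x ∈ LieAlgebra.radical K L) ∧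
      LieAlgebra.IsKilling K (L ⧸ LieAlgebra.radical K L) := by
  obtain ⟨r, ⟨hrs, hrD⟩, hmax⟩ := exists_maximal_of_wellFoundedGT
    (fun I : LieIdeal K L ↦ LieAlgebra.IsSolvable I ∧ ∀ i, ∀ x ∈ I, D i x ∈ I)
    ⟨⊥, inferInstance, fun i x hx ↦ by
      rw [LieSubmodule.mem_bot] at hx
      rw [hx, map_zero]
      exact zero_mem _⟩
  have hker : IsSolvable r.quotientMk.ker := by
    have : r.quotientMk.ker = r := LieSubmodule.ext _ _ r.quotientMk_eq_zero
    rwa [this]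
  have hext (J : LieIdeal K (L ⧸ r)) (hJ : IsSolvable J) : IsSolvable (J.comap r.quotientMk) :=
    LieIdeal.isSolvable_of_map r.quotientMk hker _ J (fun x hx ↦ hx) hJ
  have hle (J : LieIdeal K (L ⧸ r)) : r ≤ J.comap r.quotientMk := fun x hx ↦ by
    rw [LieIdeal.mem_comap, (r.quotientMk_eq_zero x).mpr hx]
    exact zero_mem _
  have hD' : IsToralFamily fun i ↦ r.quotientEnd (D i) (hrD i) :=
    hD.of_surjective r.quotientMk r.quotientMk_surjective fun i x ↦ rfl
  have hbot (J : LieIdeal K (L ⧸ r)) (h : J.comap r.quotientMk ≤ r) : J = ⊥ := by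
    refine (LieSubmodule.eq_bot_iff _).mpr fun x hx ↦ ?_
    obtain ⟨x, rfl⟩ := r.quotientMk_surjective x
    exact (r.quotientMk_eq_zero x).mpr (h hx)
  have hK : IsKilling K (L ⧸ r) := ⟨hbot _ (hmax ⟨hext _ (LieAlgebra.le_solvable_ideal_solvable
    (killingCompl_top_le_radical K _) inferInstance), fun i x hx ↦ by
      exact LieIdeal.apply_mem_killingCompl_top _ (hD'.apply_lie i) hx⟩ (hle _))⟩
  let R := radical K L
  let f : R →ₗ⁅K⁆ R.map r.quotientMk :=
    { toFun := fun x ↦ ⟨r.quotientMk x, LieIdeal.mem_map x.2⟩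
      map_add' := fun x y ↦ Subtype.ext (map_add r.quotientMk (x : L) y)
      map_smul' := fun a x ↦ Subtype.ext (map_smul r.quotientMk a (x : L))
      map_lie' := fun {x y} ↦ Subtype.ext (LieHom.map_lie r.quotientMk (x : L) y) }
  have hf : Function.Surjective f := by
    rintro ⟨y, hy⟩
    obtain ⟨x, hx⟩ := LieIdeal.mem_map_of_surjective r.quotientMk_surjective hy
    exact ⟨x, Subtype.ext hx⟩
  have hR : R.map r.quotientMk = ⊥ := by
    have := (LieIdeal.solvable_iff_le_radical K (L ⧸ r) _).mp hf.lieAlgebra_isSolvable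
    rwa [HasTrivialRadical.radical_eq_bot, le_bot_iff] at this
  have hrR : r = radical K L := by
    refine le_antisymm ((LieIdeal.solvable_iff_le_radical K L r).mp hrs) fun x hx ↦ ?_
    refine (r.quotientMk_eq_zero x).mp ?_
    have : r.quotientMk x ∈ R.map r.quotientMk := LieIdeal.mem_map hx
    rwa [hR, LieSubmodule.mem_bot] at this
  subst hrR
  exact ⟨hrD, hK⟩

end

namespace LieHom

variable {K S ι : Type*} [Field K] [CharZero K] [LieRing S] [LieAlgebra K S]
  [FiniteDimensional K S] [LieAlgebra.IsKilling K S]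

theorem exists_invariant_subalgebra_ne_top_of_isSolvable_ker {L : Type*} [LieRing L]
    [LieAlgebra K L] [FiniteDimensional K L] (f : L →ₗ⁅K⁆ S) (hf : Function.Surjective f)
    (hs : LieAlgebra.IsSolvable f.ker) (hne : f.ker ≠ ⊥) {D : ι → Module.End K L}
    (hD : LieAlgebra.IsToralFamily D) (hker : ∀ i x, f x = 0 → f (D i x) = 0) :
    ∃ l : LieSubalgebra K L, l ≠ ⊤ ∧ (∀ i, ∀ x ∈ l, D i x ∈ l) ∧ ∀ x, ∃ y ∈ l, f y = f x := by
  let b : LieIdeal K L := ⁅f.ker, f.ker⁆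
  have hb : b ≤ f.ker := LieSubmodule.lie_le_right _ _
  have hblt : ¬ f.ker ≤ b := fun h ↦ by
    obtain ⟨k, hk⟩ := (LieAlgebra.isSolvable_iff K _).mp hs
    rw [LieIdeal.derivedSeries_eq_bot_iff] at hk
    have key (k : ℕ) : LieAlgebra.derivedSeriesOfIdeal K L k f.ker = f.ker := by
      induction k with
      | zero => rfl
      | succ k ih =>
        rw [LieAlgebra.derivedSeriesOfIdeal_succ, ih]
        exact le_antisymm hb h
    exact hne ((key k).symm.trans hk)
  obtain ⟨y₀, hy₀, hy₀'⟩ := SetLike.not_le_iff_exists.mp hblt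
  have hbD (i) : ∀ x ∈ b, D i x ∈ b := by
    intro x hx
    rw [← LieSubmodule.mem_toSubmodule, LieSubmodule.lieIdeal_oper_eq_linear_span'] at hx
    induction hx using Submodule.span_induction with
    | mem x hx =>
      obtain ⟨y, hy, z, hz, rfl⟩ := hx
      rw [hD.apply_lie]
      exact add_mem (LieSubmodule.lie_mem_lie (hker i y hy) hz)
        (LieSubmodule.lie_mem_lie hy (hker i z hz))
    | zero => rw [map_zero]; exact zero_mem _
    | add y z _ _ hy hz => rw [map_add]; exact add_mem hy hz
    | smul a y _ hy => rw [map_smul]; exact SMulMemClass.smul_mem a hy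
  let f' : L ⧸ b →ₗ⁅K⁆ S :=
    { b.toSubmodule.liftQ f.toLinearMap hb with
      map_lie' := fun {x y} ↦ by
        obtain ⟨x, rfl⟩ := b.quotientMk_surjective x
        obtain ⟨y, rfl⟩ := b.quotientMk_surjective y
        exact LieHom.map_lie f x y }
  have hff' (x : L) : f' (b.quotientMk x) = f x := rfl
  have hD' : LieAlgebra.IsToralFamily fun i ↦ b.quotientEnd (D i) (hbD i) :=
    hD.of_surjective b.quotientMk b.quotientMk_surjective fun i x ↦ rfl
  obtain ⟨l, hl, hlD, hlf⟩ := f'.exists_invariant_subalgebra_ne_top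
    (fun y ↦ (hf y).imp' b.quotientMk fun x hx ↦ hx) (y₀ := b.quotientMk y₀)
    (by
      intro x y hx hy
      obtain ⟨x, rfl⟩ := b.quotientMk_surjective x
      obtain ⟨y, rfl⟩ := b.quotientMk_surjective y
      rw [← LieHom.map_lie, b.quotientMk_eq_zero]
      exact LieSubmodule.lie_mem_lie hx hy)
    hy₀ (fun h ↦ hy₀' ((b.quotientMk_eq_zero y₀).mp h)) _ hD'.apply_lie hD'.commute
    hD'.exists_separable
    (by
      intro i x hx
      obtain ⟨x, rfl⟩ := b.quotientMk_surjective x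
      exact hker i x hx)
  refine ⟨l.comap b.quotientMk, fun h ↦ hl ?_, fun i x hx ↦ hlD i _ hx, fun x ↦ ?_⟩
  · refine eq_top_iff.mpr fun x _ ↦ ?_
    obtain ⟨x, rfl⟩ := b.quotientMk_surjective x
    have hx : x ∈ l.comap b.quotientMk := h ▸ LieSubalgebra.mem_top x
    exact hx
  · obtain ⟨y, hy, hxy⟩ := hlf (b.quotientMk x)
    obtain ⟨y, rfl⟩ := b.quotientMk_surjective y
    exact ⟨y, hy, hxy⟩

/-- An extension of a Lie algebra with nondegenerate Killing form by a solvable kernel is split by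
an invariant subalgebra. -/
theorem exists_invariant_subalgebra_bijective {L : Type*} [LieRing L]
    [LieAlgebra K L] [FiniteDimensional K L] (f : L →ₗ⁅K⁆ S) (hf : Function.Surjective f)
    (hs : LieAlgebra.IsSolvable f.ker) {D : ι → Module.End K L}
    (hD : LieAlgebra.IsToralFamily D) (hker : ∀ i x, f x = 0 → f (D i x) = 0) :
    ∃ l : LieSubalgebra K L, (∀ i, ∀ x ∈ l, D i x ∈ l) ∧ Function.Bijective (f.comp l.incl) := by
  induction hn : Module.finrank K L using Nat.strong_induction_on generalizing L with
  | _ n ih =>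
  by_cases hne : f.ker = ⊥
  · refine ⟨⊤, fun _ _ _ ↦ LieSubalgebra.mem_top _, fun x y h ↦ ?_, fun y ↦ ?_⟩
    · exact Subtype.ext ((LieHom.ker_eq_bot f).mp hne h)
    · exact (hf y).imp' (fun x ↦ ⟨x, LieSubalgebra.mem_top x⟩) fun x hx ↦ hx
  obtain ⟨l, hl, hlD, hlf⟩ :=
    f.exists_invariant_subalgebra_ne_top_of_isSolvable_ker hf hs hne hD hker
  have hlt : Module.finrank K l < n :=
    hn ▸ Submodule.finrank_lt fun h ↦ hl (LieSubalgebra.toSubmodule_injective h)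
  have hs' : LieAlgebra.IsSolvable (f.comp l.incl).ker := by
    let g : (f.comp l.incl).ker →ₗ⁅K⁆ f.ker :=
      { toFun := fun x ↦ ⟨l.incl x, x.2⟩
        map_add' := fun x y ↦ rfl
        map_smul' := fun a x ↦ rfl
        map_lie' := fun {x y} ↦ rfl }
    have hg : Function.Injective g := fun x y h ↦
      Subtype.ext (Subtype.ext (congrArg (fun z : f.ker ↦ (z : L)) h))
    exact hg.lieAlgebra_isSolvable
  obtain ⟨m, hmD, hm⟩ := ih _ hlt (f.comp l.incl)
    (fun y ↦ by
      obtain ⟨x, rfl⟩ := hf y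
      obtain ⟨z, hz, hxz⟩ := hlf x
      exact ⟨⟨z, hz⟩, hxz⟩)
    hs' (D := fun i ↦ (D i).restrict (hlD i))
    (hD.of_injective l.incl Subtype.val_injective fun i x ↦ rfl)
    (fun i x hx ↦ hker i x hx) rfl
  refine ⟨m.map l.incl, fun i x hx ↦ ?_, fun x y h ↦ ?_, fun y ↦ ?_⟩
  · obtain ⟨x, hx', rfl⟩ := (LieSubalgebra.mem_map _ _ _).mp hx
    exact (LieSubalgebra.mem_map _ _ _).mpr ⟨_, hmD i x hx', rfl⟩
  · obtain ⟨_, x, hx, rfl⟩ := x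
    obtain ⟨_, y, hy, rfl⟩ := y
    have := @hm.1 ⟨x, hx⟩ ⟨y, hy⟩ h
    exact Subtype.ext (congrArg (fun z : m ↦ ((z : l) : L)) this)
  · obtain ⟨x, rfl⟩ := hm.2 y
    exact ⟨⟨l.incl x, x, x.2, rfl⟩, rfl⟩

end LieHom

/-- Theorem 1: a commuting family of semisimple derivations of a finite-dimensional real Lie
algebra leaves some Levi subalgebra invariant. -/
theorem exists_invariant_levi_of_commuting_semisimple_derivations
    (g : Type*) [LieRing g] [LieAlgebra ℝ g] [FiniteDimensional ℝ g]
    (S : Set (LieDerivation ℝ g g))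
    (hcomm : ∀ δ ∈ S, ∀ δ' ∈ S, Commute (δ.toLinearMap : Module.End ℝ g) (δ'.toLinearMap : Module.End ℝ g))
    (hss : ∀ δ ∈ S, Module.End.IsSemisimple (δ.toLinearMap : Module.End ℝ g)) :
    ∃ l : LieSubalgebra ℝ g, IsLeviSubalgebra g l ∧ ∀ δ ∈ S, ∀ x ∈ l, δ x ∈ l := by
  let D (i : S) : Module.End ℝ g := (i : LieDerivation ℝ g g).toLinearMap
  have hD : LieAlgebra.IsToralFamily D :=
    { apply_lie := fun i x y ↦
        (i : LieDerivation ℝ g g).apply_lie_eq_add x y |>.trans (add_comm _ _)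
      commute := fun i j ↦ hcomm i i.2 j j.2
      exists_separable := fun i ↦ ⟨minpoly ℝ (D i), PerfectField.separable_iff_squarefree.mpr
        (hss i i.2).minpoly_squarefree, minpoly.aeval _ _⟩ }
  obtain ⟨hr, _⟩ := hD.radical_invariant_and_isKilling_quotient
  let r := LieAlgebra.radical ℝ g
  have hker : r.quotientMk.ker = r := LieSubmodule.ext _ _ r.quotientMk_eq_zero
  obtain ⟨l, hlD, hl⟩ := r.quotientMk.exists_invariant_subalgebra_bijective r.quotientMk_surjective
    (by rw [hker]; infer_instance) hD
    (fun i x hx ↦ (r.quotientMk_eq_zero _).mpr (hr i x ((r.quotientMk_eq_zero x).mp hx)))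
  have hlK : LieAlgebra.IsKilling ℝ l :=
    LieAlgebra.isKilling_of_equiv (LieEquiv.ofBijective _ hl).symm
  refine ⟨l, ⟨inferInstance, ?_⟩, fun δ hδ ↦ hlD ⟨δ, hδ⟩⟩
  refine IsCompl.of_eq ((Submodule.eq_bot_iff _).mpr fun x hx ↦ ?_) (eq_top_iff.mpr fun x _ ↦ ?_)
  · have := @hl.1 ⟨x, hx.1⟩ 0 (((r.quotientMk_eq_zero x).mpr hx.2).trans (map_zero _).symm)
    exact congrArg Subtype.val this
  · obtain ⟨y, hy⟩ := hl.2 (r.quotientMk x)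
    refine Submodule.mem_sup.mpr ⟨y, y.2, x - y, ?_, add_sub_cancel _ _⟩
    refine (r.quotientMk_eq_zero _).mp ?_
    rw [map_sub, sub_eq_zero]
    exact hy.symm
end

section
/- Let g be a finite-dimensional real Lie algebra graded over ℤ^d: that is, g = Σ_{m ∈ ℤ^d} g_m is an internal direct sum of subspaces g_m (all but finitely many zero) with ⁅g_m, g_n⁆ ⊆ g_{m+n} for all m, n ∈ ℤ^d. Then the radical r of g satisfies r = Σ_{m} (r ∩ g_m), and there exists a Levi subalgebra l of g satisfying l = Σ_{m} (l ∩ g_m). -/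
open Module LieModule

section Casimir

variable {K L : Type*} [Field K] [LieRing L]
variable {M : Type*} [AddCommGroup M] [Module K M] [LieRingModule L M]

/-- The canonical tensor attached to an invariant nondegenerate form is invariant. -/
lemma sum_apply_lie_dualBasis_eq_zero {ι : Type*} [Fintype ι] [DecidableEq ι]
    {Φ : LinearMap.BilinForm K M} (hΦ : Φ.Nondegenerate)
    (hinv : Φ.lieInvariant L) (b : Basis ι K M) {W : Type*} [AddCommGroup W] [Module K W]
    (β : M →ₗ[K] M →ₗ[K] W) (x : L) :
    ∑ i, β ⁅x, b i⁆ (Φ.dualBasis hΦ b i) + ∑ i, β (b i) ⁅x, Φ.dualBasis hΦ b i⁆ = 0 := by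
  set b' := Φ.dualBasis hΦ b with hb'
  have h1 (m : M) : m = ∑ j, Φ (b' j) m • b j := by
    conv_lhs => rw [← b.sum_repr m]
    refine Finset.sum_congr rfl fun j _ ↦ ?_
    congr 1
    have h : Φ (b' j) (∑ i, b.repr m i • b i) = b.repr m j := by
      simp only [map_sum, map_smul, hb', LinearMap.BilinForm.apply_dualBasis_left]
      simp
    rw [b.sum_repr] at h
    exact h.symm
  have h2 (m : M) : m = ∑ j, Φ m (b j) • b' j := by
    conv_lhs => rw [← b'.sum_repr m]
    simp [hb', LinearMap.BilinForm.dualBasis_repr_apply]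
  have e1 (i : ι) : β ⁅x, b i⁆ (b' i) = ∑ j, Φ (b' j) ⁅x, b i⁆ • β (b j) (b' i) := by
    conv_lhs => rw [h1 ⁅x, b i⁆]
    simp
  have e2 (i : ι) : β (b i) ⁅x, b' i⁆ = ∑ j, Φ ⁅x, b' i⁆ (b j) • β (b i) (b' j) := by
    conv_lhs => rw [h2 ⁅x, b' i⁆]
    simp
  simp_rw [e1, e2]
  rw [Finset.sum_comm, ← Finset.sum_add_distrib]
  refine Finset.sum_eq_zero fun i _ ↦ ?_
  rw [← Finset.sum_add_distrib]
  refine Finset.sum_eq_zero fun j _ ↦ ?_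
  rw [hinv x (b' i) (b j), neg_smul, add_neg_cancel]

end Casimir

section

open LieModule.Cohomology

variable {K L : Type*} [Field K] [LieRing L] [LieAlgebra K L]
variable {V : Type*} [AddCommGroup V] [Module K V] [LieRingModule L V] [LieModule K L V]

/-- If the trace form of `V` is nondegenerate on an ideal `J`, then the Casimir operator of `V`
relative to `J` has trace `dim J`, and it annihilates the second cohomology of `V`. -/
lemma exists_casimir [FiniteDimensional K L] (J : LieIdeal K L)
    (hJ : ((traceForm K L V).restrict J.toSubmodule).Nondegenerate) :
    ∃ Ω : V →ₗ⁅K, L⁆ V, LinearMap.trace K V (Ω : V →ₗ[K] V) = finrank K J ∧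
      ∀ a ∈ twoCocycle K L V, ∃ h : L →ₗ[K] V, ∀ x y, d₁₂ K L V h x y = Ω (a x y) := by
  classical
  let Φ : LinearMap.BilinForm K J := (traceForm K L V).restrict J.toSubmodule
  have hsymm : Φ.IsSymm := ⟨fun x y ↦ traceForm_comm K L V x y⟩
  have hinv : Φ.lieInvariant L := fun x y z ↦ traceForm_lieInvariant K L V x y z
  let b := finBasis K J
  let e (i) : L := b i
  let e' (i) : L := Φ.dualBasis hJ b i
  have key (β : L →ₗ[K] L →ₗ[K] V) (x : L) :
      ∑ i, β ⁅x, e i⁆ (e' i) + ∑ i, β (e i) ⁅x, e' i⁆ = 0 :=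
    sum_apply_lie_dualBasis_eq_zero (M := J) hJ hinv b
      (β.compl₁₂ J.toSubmodule.subtype J.toSubmodule.subtype) x
  let T : V →ₗ[K] V := ∑ i, toEnd K L V (e i) ∘ₗ toEnd K L V (e' i)
  have hT (v : V) : T v = ∑ i, ⁅e i, ⁅e' i, v⁆⁆ := by simp [T]
  let Ω : V →ₗ⁅K, L⁆ V :=
    { T with
      map_lie' := by
        intro x v
        have := key ((LinearMap.mk₂ K (fun p q : L ↦ ⁅p, ⁅q, v⁆⁆) (by simp) (by simp) (by simp)
          (by simp)) : L →ₗ[K] L →ₗ[K] V) x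
        simp only [LinearMap.mk₂_apply, ← Finset.sum_add_distrib] at this
        change T ⁅x, v⁆ = ⁅x, T v⁆
        rw [hT, hT, lie_sum, eq_comm, ← sub_eq_zero, ← Finset.sum_sub_distrib, ← this]
        refine Finset.sum_congr rfl fun i _ ↦ ?_
        simp only [lie_lie, lie_sub]
        abel }
  refine ⟨Ω, ?_, fun a ha ↦ ?_⟩
  · change LinearMap.trace K V T = _
    have htr (i) : LinearMap.trace K V (toEnd K L V (e i) ∘ₗ toEnd K L V (e' i)) = 1 := by
      have := Φ.apply_dualBasis_right hJ hsymm b i i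
      rwa [if_pos rfl] at this
    simp [T, htr]
  · rw [mem_twoCocycle_iff] at ha
    refine ⟨∑ i, toEnd K L V (e i) ∘ₗ a (e' i), fun x y ↦ ?_⟩
    have k1 := key ((LinearMap.mk₂ K (fun p q : L ↦ ⁅p, a q y⁆) (by simp) (by simp) (by simp)
          (by simp)) : L →ₗ[K] L →ₗ[K] V) x
    have k2 := key ((LinearMap.mk₂ K (fun p q : L ↦ ⁅p, a q x⁆) (by simp) (by simp) (by simp)
          (by simp)) : L →ₗ[K] L →ₗ[K] V) y
    simp only [LinearMap.mk₂_apply, ← Finset.sum_add_distrib] at k1 k2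
    have k3 : ∑ i, ⁅e i, d₂₃ K L V a (e' i) x y⁆ = 0 := by simp [ha]
    change _ = T (a x y)
    rw [hT, d₁₂_apply_apply]
    simp only [LinearMap.sum_apply, LinearMap.comp_apply, toEnd_apply_apply, lie_sum]
    rw [← sub_eq_zero, ← neg_eq_zero, ← k3, ← sub_eq_zero]
    trans (∑ i, (⁅⁅y, e i⁆, (a (e' i)) x⁆ + ⁅e i, (a ⁅y, e' i⁆) x⁆)) -
      (∑ i, (⁅⁅x, e i⁆, (a (e' i)) y⁆ + ⁅e i, (a ⁅x, e' i⁆) y⁆))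
    · simp only [← Finset.sum_sub_distrib, ← Finset.sum_neg_distrib]
      refine Finset.sum_congr rfl fun i _ ↦ ?_
      rw [d₂₃_apply, ← lie_skew x (e' i), ← lie_skew y (e' i), ← twoCochain_skew a ⁅x, y⁆]
      simp only [lie_lie, lie_sub, lie_add, map_neg, lie_neg, LinearMap.neg_apply]
      abel
    · rw [k1, k2, sub_zero]

end

section Whitehead

open LieModule.Cohomology LieAlgebra

variable {K L : Type*} [Field K] [LieRing L] [LieAlgebra K L] [FiniteDimensional K L]

lemma LieAlgebra.IsKilling.lie_top_top [IsKilling K L] :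
    ⁅(⊤ : LieIdeal K L), (⊤ : LieIdeal K L)⁆ = ⊤ := by
  set D := ⁅(⊤ : LieIdeal K L), (⊤ : LieIdeal K L)⁆ with hD
  suffices D.killingCompl = ⊥ by simpa [this] using D.isCompl_killingCompl.sup_eq_top
  rw [LieSubmodule.eq_bot_iff]
  intro x hx
  rw [LieIdeal.mem_killingCompl] at hx
  have hc : x ∈ center K L := by
    rw [mem_maxTrivSubmodule]
    intro y
    refine (killingForm_nondegenerate K L).1 _ fun z ↦ ?_
    rw [← lie_skew, map_neg, LinearMap.neg_apply, traceForm_apply_lie_apply, traceForm_comm,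
      hx _ (LieSubmodule.lie_mem_lie (LieSubmodule.mem_top y) (LieSubmodule.mem_top z)), neg_zero]
  simpa using hc

/-- **Whitehead's second lemma** with scalar coefficients. -/
lemma LieAlgebra.IsKilling.exists_eq_killingForm_lie [IsKilling K L] (ω : L →ₗ[K] L →ₗ[K] K)
    (hω : ∀ x y z, ω x ⁅y, z⁆ = ω ⁅x, y⁆ z + ω y ⁅x, z⁆) :
    ∃ z, ∀ x y, ω x y = killingForm K L z ⁅x, y⁆ := by
  have hκ := killingForm_nondegenerate K L
  let D : L →ₗ[K] L := (LinearMap.BilinForm.toDual (killingForm K L) hκ).symm ∘ₗ ω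
  have hD (x y) : killingForm K L (D x) y = ω x y := by
    simp [D]
  let D' : LieDerivation K L L :=
    { D with
      leibniz' x y := by
        change D _ = ⁅x, D y⁆ - ⁅y, D x⁆
        rw [← sub_eq_zero]
        refine hκ.1 _ fun z ↦ ?_
        rw [← lie_skew x (D y), ← lie_skew y (D x)]
        simp only [map_sub, map_neg, LinearMap.sub_apply, LinearMap.neg_apply,
          traceForm_apply_lie_apply, hD, hω x y z]
        ring }
  obtain ⟨z, hz⟩ := LieDerivation.IsKilling.exists_eq_ad D'
  refine ⟨z, fun x y ↦ ?_⟩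
  rw [← hD, ← traceForm_apply_lie_apply]
  congr 2
  simpa [D'] using congr($hz.symm x)

variable {V : Type*} [AddCommGroup V] [Module K V] [LieRingModule L V] [LieModule K L V]

lemma exists_d₁₂_eq_of_isTrivial [IsKilling K L] [FiniteDimensional K V] [LieModule.IsTrivial L V]
    (a : twoCochain K L V) (ha : a ∈ twoCocycle K L V) : ∃ h, d₁₂ K L V h = a := by
  rw [mem_twoCocycle_iff_of_trivial] at ha
  let b := finBasis K V
  have hb (i) : ∃ z, ∀ x y, b.coord i (a x y) = killingForm K L z ⁅x, y⁆ :=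
    IsKilling.exists_eq_killingForm_lie (a.1.compr₂ (b.coord i)) fun x y z ↦ by
      simpa using congr(b.coord i $(ha x y z))
  choose z hz using hb
  refine ⟨-∑ i, (killingForm K L (z i)).smulRight (b i), ?_⟩
  ext x y
  rw [twoCochain_val_apply, d₁₂_apply_apply_ofTrivial]
  simp only [LinearMap.neg_apply, LinearMap.sum_apply, LinearMap.smulRight_apply, neg_neg, ← hz]
  exact b.sum_repr _

lemma LieModule.isTrivial_of_traceForm_eq_zero_s1 [CharZero K] [IsKilling K L] [FiniteDimensional K V]
    [LieModule.IsIrreducible K L V] (h : traceForm K L V = 0) : LieModule.IsTrivial L V := by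
  have hnil : LieModule.IsNilpotent L V := by
    have h1 := isNilpotent_derivedSeries_of_traceForm_eq_zero h
    rw [isNilpotent_iff_forall' (R := K)] at h1 ⊢
    intro x
    have hx : x ∈ derivedSeries K L 1 := by
      change x ∈ ⁅(⊤ : LieIdeal K L), (⊤ : LieIdeal K L)⁆
      rw [IsKilling.lie_top_top]
      trivial
    exact h1 ⟨x, hx⟩
  rw [trivial_iff_lower_central_eq_bot (R := K)]
  refine (IsSimpleOrder.eq_bot_or_eq_top _).resolve_right fun htop ↦ ?_
  obtain ⟨k, hk⟩ := IsNilpotent.nilpotent K L V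
  have (k : ℕ) : lowerCentralSeries K L V k = ⊤ := by
    induction k with
    | zero => simp
    | succ k ih => rw [lowerCentralSeries_succ, ih]; simpa using htop
  exact bot_ne_top (hk.symm.trans (this k))

lemma exists_d₁₂_eq_of_isIrreducible [CharZero K] [IsKilling K L] [FiniteDimensional K V]
    [LieModule.IsIrreducible K L V]
    (a : twoCochain K L V) (ha : a ∈ twoCocycle K L V) : ∃ h, d₁₂ K L V h = a := by
  let N : LieIdeal K L :=
    LieAlgebra.InvariantForm.orthogonal (traceForm K L V) (traceForm_lieInvariant K L V) ⊤
  have hN (x) : x ∈ N ↔ ∀ y, traceForm K L V y x = 0 := by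
    simp [N, LieAlgebra.InvariantForm.mem_orthogonal]
  let J := N.killingCompl
  have hNJ : IsCompl N J := N.isCompl_killingCompl
  by_cases hJ : J = ⊥
  · have htop : N = ⊤ := by simpa [hJ] using hNJ.sup_eq_top
    have := LieModule.isTrivial_of_traceForm_eq_zero_s1 (K := K) (L := L) (V := V) <| by
      ext y x
      exact (hN x).1 (htop ▸ LieSubmodule.mem_top x) y
    exact exists_d₁₂_eq_of_isTrivial a ha
  have hnd : ((traceForm K L V).restrict J.toSubmodule).Nondegenerate := by
    have hrefl : ((traceForm K L V).restrict J.toSubmodule).IsRefl :=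
      LinearMap.IsSymm.isRefl ⟨fun x y ↦ traceForm_comm K L V x y⟩
    refine hrefl.nondegenerate_iff_separatingLeft.2 fun x hx ↦ ?_
    have hxN : (x : L) ∈ N := by
      rw [hN]
      intro y
      obtain ⟨n, hn, j, hj, rfl⟩ :=
        (LieSubmodule.mem_sup N J y).1 (hNJ.sup_eq_top ▸ LieSubmodule.mem_top y)
      rw [map_add, LinearMap.add_apply, traceForm_comm K L V n, (hN n).1 hn, zero_add,
        traceForm_comm]
      exact hx ⟨j, hj⟩
    have : (x : L) ∈ N ⊓ J := ⟨hxN, x.2⟩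
    rw [hNJ.inf_eq_bot] at this
    exact Subtype.ext this
  obtain ⟨Ω, htr, hΩ⟩ := exists_casimir (V := V) J hnd
  obtain ⟨h, hh⟩ := hΩ a ha
  have hinj : Function.Injective Ω := by
    rw [← LieModuleHom.ker_eq_bot]
    refine (IsSimpleOrder.eq_bot_or_eq_top _).resolve_right fun htop ↦ hJ ?_
    have h0 : (Ω : V →ₗ[K] V) = 0 := by
      ext v
      have : v ∈ Ω.ker := htop ▸ LieSubmodule.mem_top v
      simpa using this
    rw [h0, map_zero, eq_comm, Nat.cast_eq_zero] at htr
    rw [← LieSubmodule.toSubmodule_eq_bot]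
    exact Submodule.finrank_eq_zero.1 htr
  let e : V ≃ₗ[K] V := LinearEquiv.ofInjectiveEndo (Ω : V →ₗ[K] V) hinj
  have he (v) : Ω (e.symm v) = v := e.apply_symm_apply v
  refine ⟨e.symm.toLinearMap ∘ₗ h, ?_⟩
  ext x y
  apply hinj
  change _ = Ω (a x y)
  rw [← hh]
  change Ω (d₁₂ K L V (e.symm.toLinearMap ∘ₗ h) x y) = _
  simp [he]

/-- **Whitehead's second lemma**: the second cohomology of a semisimple Lie algebra with
finite-dimensional coefficients vanishes. -/
theorem exists_d₁₂_eq [CharZero K] [IsKilling K L] [FiniteDimensional K V]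
    (a : twoCochain K L V) (ha : a ∈ twoCocycle K L V) : ∃ h, d₁₂ K L V h = a := by
  induction hn : finrank K V using Nat.strong_induction_on generalizing V with
  | _ n ih =>
  rcases subsingleton_or_nontrivial V with hV | hV
  · exact ⟨0, by ext; exact Subsingleton.elim _ _⟩
  by_cases hirr : LieModule.IsIrreducible K L V
  · exact exists_d₁₂_eq_of_isIrreducible a ha
  obtain ⟨U, hU0, hU1⟩ : ∃ U : LieSubmodule K L V, U ≠ ⊥ ∧ U ≠ ⊤ := by
    by_contra! hU
    exact hirr (.mk hU)
  rw [mem_twoCocycle_iff] at ha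
  let q := LieSubmodule.Quotient.mk' U
  have hltU : finrank K U < n := hn ▸ Submodule.finrank_lt (by simpa using hU1)
  have hltQ : finrank K (V ⧸ U) < n := by
    have h1 := Submodule.finrank_quotient_add_finrank U.toSubmodule
    have h2 : 0 < finrank K U.toSubmodule := by
      rw [Nat.pos_iff_ne_zero, Ne, Submodule.finrank_eq_zero]; simpa using hU0
    have h3 : finrank K (V ⧸ U) = finrank K (V ⧸ U.toSubmodule) := rfl
    omega
  obtain ⟨h₁, hh₁⟩ := ih _ hltQ
    (⟨a.1.compr₂ (q : V →ₗ[K] V ⧸ U), fun x ↦ by simp⟩ : twoCochain K L (V ⧸ U)) (by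
      rw [mem_twoCocycle_iff]
      ext x y z
      have := congr(q ($ha x y z))
      simp only [d₂₃_apply, map_sub, map_add, LieModuleHom.map_lie] at this
      exact this) rfl
  obtain ⟨s, hs⟩ := (q : V →ₗ[K] V ⧸ U).exists_rightInverse_of_surjective
    (LinearMap.range_eq_top.2 (LieSubmodule.Quotient.surjective_mk' U))
  have hs' (v) : q (s v) = v := congr($hs v)
  let c : twoCochain K L V := a - d₁₂ K L V (s ∘ₗ h₁)
  have hc (x y) : c x y ∈ U := by
    rw [← LieSubmodule.Quotient.mk_eq_zero]
    have := congr($hh₁ x y)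
    change q (a x y - (⁅x, s (h₁ y)⁆ - ⁅y, s (h₁ x)⁆ - s (h₁ ⁅x, y⁆))) = 0
    simp only [map_sub, LieModuleHom.map_lie, hs']
    rw [sub_eq_zero]
    exact this.symm
  have hcc : d₂₃ K L V c = 0 := by
    have := congr($(d₂₃_comp_d₁₂ K L V) (s ∘ₗ h₁))
    simp only [LinearMap.comp_apply, LinearMap.zero_apply] at this
    have hac : c + d₁₂ K L V (s ∘ₗ h₁) = a := by
      ext x y
      exact sub_add_cancel (a x y) _
    rw [← hac, map_add, this, add_zero] at ha
    exact ha
  obtain ⟨h₂, hh₂⟩ := ih _ hltU (V := U)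
    (⟨LinearMap.mk₂ K (fun x y ↦ (⟨c x y, hc x y⟩ : U)) (by intros; ext; simp)
      (by intros; ext; simp) (by intros; ext; simp) (by intros; ext; simp),
      fun x ↦ by ext; simp⟩ : twoCochain K L U) (by
      rw [mem_twoCocycle_iff]
      ext x y z
      exact congr($hcc x y z)) rfl
  refine ⟨U.toSubmodule.subtype ∘ₗ h₂ + s ∘ₗ h₁, ?_⟩
  ext x y
  have := congr((($hh₂ x y : U) : V))
  rw [map_add]
  change d₁₂ K L V (U.toSubmodule.subtype ∘ₗ h₂) x y + d₁₂ K L V (s ∘ₗ h₁) x y = a x y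
  rw [← eq_sub_iff_add_eq]
  exact this

end Whitehead

section Lift

open LieModule.Cohomology LieAlgebra

variable {K L s V : Type*} [Field K] [CharZero K] [LieRing L] [LieAlgebra K L]
  [LieRing s] [LieAlgebra K s] [FiniteDimensional K s] [IsKilling K s]
  [AddCommGroup V] [Module K V] [FiniteDimensional K V] [LieRingModule L V] [LieModule K L V]

lemma exists_derivation_eqOn_ker_of_compatible [LieRingModule s V] [LieModule K s V]
    {q : L →ₗ⁅K⁆ s} (hq : Function.Surjective q) (hqV : ∀ (x : L) (v : V), ⁅q x, v⁆ = ⁅x, v⁆)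
    (φ : L →ₗ[K] V) (hφ : ∀ x a : L, q a = 0 → φ ⁅x, a⁆ = ⁅x, φ a⁆) :
    ∃ c : L →ₗ[K] V, (∀ x y, c ⁅x, y⁆ = ⁅x, c y⁆ - ⁅y, c x⁆) ∧ ∀ a, q a = 0 → c a = φ a := by
  obtain ⟨σ, hσ⟩ := (q : L →ₗ[K] s).exists_rightInverse_of_surjective (LinearMap.range_eq_top.2 hq)
  have hσ' (x) : q (σ x) = x := congr($hσ x)
  have hσV (x) (v : V) : ⁅σ x, v⁆ = ⁅x, v⁆ := by rw [← hqV, hσ']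
  have hker (x a) (ha : q a = 0) : d₁₂ K L V φ x a = 0 := by
    rw [d₁₂_apply_apply, hφ x a ha, ← hqV a, ha, zero_lie]; simp
  have hdesc (x y z) (h : q y = q z) : d₁₂ K L V φ x y = d₁₂ K L V φ x z := by
    rw [← sub_eq_zero, ← map_sub]
    exact hker x _ (by rw [map_sub, h, sub_self])
  have hdesc' (x y z) (h : q x = q y) : d₁₂ K L V φ x z = d₁₂ K L V φ y z := by
    rw [← twoCochain_skew, ← twoCochain_skew _ z y, hdesc z x y h]
  let a : twoCochain K s V :=
    ⟨(d₁₂ K L V φ).1.compl₁₂ σ σ, fun x ↦ twoCochain_alt (d₁₂ K L V φ) (σ x)⟩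
  have haσ (x y) : a x y = d₁₂ K L V φ (σ x) (σ y) := rfl
  have haq (x y) : a (q x) (q y) = d₁₂ K L V φ x y := by
    rw [haσ, hdesc _ _ _ (hσ' _), hdesc' _ _ _ (hσ' _)]
  obtain ⟨h, hh⟩ := exists_d₁₂_eq a (by
    rw [mem_twoCocycle_iff]
    ext x y z
    have := congr($(d₂₃_comp_d₁₂ K L V) φ (σ x) (σ y) (σ z))
    simp only [LinearMap.comp_apply, LinearMap.zero_apply, d₂₃_apply] at this
    rw [← haq, ← haq, ← haq, ← haq, ← haq, ← haq, hσV, hσV, hσV, LieHom.map_lie, LieHom.map_lie,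
      LieHom.map_lie, hσ', hσ', hσ'] at this
    exact this)
  refine ⟨φ - h ∘ₗ (q : L →ₗ[K] s), fun x y ↦ ?_, fun a ha ↦ ?_⟩
  · have h1 := congr($hh (q x) (q y))
    rw [haq, d₁₂_apply_apply, d₁₂_apply_apply, hqV, hqV] at h1
    simp only [LinearMap.sub_apply, LinearMap.comp_apply, LieHom.coe_toLinearMap, LieHom.map_lie,
      lie_sub]
    grind
  · simp [ha]

/-- A module homomorphism on an ideal with semisimple quotient acting trivially on the target
extends to a derivation of the whole Lie algebra. -/
lemma exists_derivation_eqOn_ker {q : L →ₗ⁅K⁆ s} (hq : Function.Surjective q)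
    (hqV : ∀ (x : L) (v : V), q x = 0 → ⁅x, v⁆ = 0)
    (φ : L →ₗ[K] V) (hφ : ∀ x a : L, q a = 0 → φ ⁅x, a⁆ = ⁅x, φ a⁆) :
    ∃ c : L →ₗ[K] V, (∀ x y, c ⁅x, y⁆ = ⁅x, c y⁆ - ⁅y, c x⁆) ∧ ∀ a, q a = 0 → c a = φ a := by
  obtain ⟨σ, hσ⟩ := (q : L →ₗ[K] s).exists_rightInverse_of_surjective (LinearMap.range_eq_top.2 hq)
  have hσ' (x) : q (σ x) = x := congr($hσ x)
  have key (x y) (v : V) (h : q x = q y) : ⁅x, v⁆ = ⁅y, v⁆ := by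
    rw [← sub_eq_zero, ← sub_lie]
    exact hqV _ v (by rw [map_sub, h, sub_self])
  let _ : LieRingModule s V :=
    { bracket x v := ⁅σ x, v⁆
      add_lie x y v := by simp
      lie_add x v w := by simp
      leibniz_lie x y v := by
        change ⁅σ x, ⁅σ y, v⁆⁆ = ⁅σ ⁅x, y⁆, v⁆ + ⁅σ y, ⁅σ x, v⁆⁆
        rw [leibniz_lie, key ⁅σ x, σ y⁆ (σ ⁅x, y⁆) v (by simp [hσ'])] }
  let _ : LieModule K s V :=
    { smul_lie t x v := by change ⁅σ (t • x), v⁆ = t • ⁅σ x, v⁆; simp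
      lie_smul t x v := lie_smul t (σ x) v }
  exact exists_derivation_eqOn_ker_of_compatible hq (fun x v ↦ key _ _ v (hσ' _)) φ hφ

end Lift

section Approx

open LieAlgebra

variable {K g : Type*} [Field K] [CharZero K] [LieRing g] [LieAlgebra K g] [FiniteDimensional K g]

lemma exists_projection_modulo_lie (R : LieIdeal K g) [IsKilling K (g ⧸ R)] (A : LieIdeal K g)
    (h : LieSubalgebra K g) (hA : ∀ x, x ∈ A ↔ x ∈ h ∧ x ∈ R) (hR : ∀ x, ∃ y ∈ h, x - y ∈ R) :
    ∃ π : g →ₗ[K] g, (∀ x, π x ∈ A) ∧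
      (∀ x ∈ h, ∀ y ∈ h, π ⁅x, y⁆ - (⁅x, π y⁆ - ⁅y, π x⁆) ∈ ⁅A, A⁆) ∧
      ∀ a ∈ A, π a - a ∈ ⁅A, A⁆ := by
  let N : LieSubmodule K g A := LieSubmodule.comap (LieSubmodule.incl A) ⁅A, A⁆
  have hN (a : A) : LieSubmodule.Quotient.mk' N a = 0 ↔ (a : g) ∈ ⁅A, A⁆ :=
    LieSubmodule.Quotient.mk_eq_zero _
  let q : h →ₗ⁅K⁆ g ⧸ R :=
    { toLinearMap := (LieSubmodule.Quotient.mk' R : g →ₗ[K] g ⧸ R) ∘ₗ h.toSubmodule.subtype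
      map_lie' := rfl }
  have hq0 (x : h) : q x = 0 ↔ (x : g) ∈ A := by
    rw [hA, and_iff_right x.2]
    exact LieSubmodule.Quotient.mk_eq_zero _
  have hq : Function.Surjective q := by
    intro z
    obtain ⟨x, rfl⟩ := LieSubmodule.Quotient.surjective_mk' R z
    obtain ⟨y, hy, hxy⟩ := hR x
    refine ⟨⟨y, hy⟩, ?_⟩
    rw [eq_comm, ← sub_eq_zero]
    change LieSubmodule.Quotient.mk' R x - LieSubmodule.Quotient.mk' R y = 0
    rw [← map_sub]
    exact LieSubmodule.Quotient.mk_eq_zero _ |>.2 hxy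
  obtain ⟨P, hP⟩ := A.toSubmodule.subtype.exists_leftInverse_of_injective
    (LinearMap.ker_eq_bot.2 Subtype.val_injective)
  have hPA (a : A) : P a = a := congr($hP a)
  obtain ⟨P', hP'⟩ := h.toSubmodule.subtype.exists_leftInverse_of_injective
    (LinearMap.ker_eq_bot.2 Subtype.val_injective)
  have hPh (a : h) : P' a = a := congr($hP' a)
  obtain ⟨t, ht⟩ := (LieSubmodule.Quotient.mk' N : A →ₗ[K] A ⧸ N).exists_rightInverse_of_surjective
    (LinearMap.range_eq_top.2 (LieSubmodule.Quotient.surjective_mk' N))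
  have ht' (v) : LieSubmodule.Quotient.mk' N (t v) = v := congr($ht v)
  obtain ⟨c, hc, hcA⟩ := exists_derivation_eqOn_ker (V := A ⧸ N) hq (by
    intro x v hx
    obtain ⟨v, rfl⟩ := LieSubmodule.Quotient.surjective_mk' N v
    change ⁅(x : g), LieSubmodule.Quotient.mk' N v⁆ = 0
    rw [← LieModuleHom.map_lie, hN]
    exact LieSubmodule.lie_mem_lie ((hq0 x).1 hx) v.2)
    ((LieSubmodule.Quotient.mk' N : A →ₗ[K] A ⧸ N) ∘ₗ P ∘ₗ h.toSubmodule.subtype) (by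
    intro x a ha
    rw [hq0] at ha
    have h1 : P a = ⟨a, ha⟩ := hPA ⟨a, ha⟩
    have h2 : P ⁅(x : g), (a : g)⁆ = ⁅(x : g), (⟨a, ha⟩ : A)⁆ := hPA ⁅(x : g), (⟨a, ha⟩ : A)⁆
    change LieSubmodule.Quotient.mk' N (P ⁅(x : g), (a : g)⁆)
      = ⁅(x : g), LieSubmodule.Quotient.mk' N (P a)⁆
    rw [h1, h2, LieModuleHom.map_lie])
  refine ⟨A.toSubmodule.subtype ∘ₗ t ∘ₗ c ∘ₗ P', fun x ↦ (t (c (P' x))).2, fun x hx y hy ↦ ?_,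
    fun a ha ↦ ?_⟩
  · lift x to h using hx
    lift y to h using hy
    have h1 : P' ⁅(x : g), (y : g)⁆ = ⁅x, y⁆ := hPh ⁅x, y⁆
    have := hN (t (c ⁅x, y⁆) - (⁅(x : g), t (c y)⁆ - ⁅(y : g), t (c x)⁆))
    simp only [map_sub, LieModuleHom.map_lie, ht'] at this
    have := this.1 (by rw [hc]; exact sub_self _)
    simpa [h1, hPh] using this
  · have hah := ((hA a).1 ha).1
    have h1 : P a = ⟨a, ha⟩ := hPA ⟨a, ha⟩
    have h2 : c ⟨a, hah⟩ = LieSubmodule.Quotient.mk' N (P a) := hcA ⟨a, hah⟩ ((hq0 _).2 ha)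
    have h3 : P' a = ⟨a, hah⟩ := hPh ⟨a, hah⟩
    have := hN (t (c (P' a)) - ⟨a, ha⟩)
    simp only [map_sub, ht', h3, h2, h1, sub_self, true_iff] at this
    simpa [h3, h2, h1] using this

end Approx

section Graded

open LieAlgebra DirectSum

variable {K g ι : Type*} [Field K] [LieRing g] [LieAlgebra K g] [DecidableEq ι]
  (p : ι → Submodule K g) [Decomposition p]

/-- The projection of a graded Lie algebra onto its component of degree `m`. -/
noncomputable def homogeneousPart (m : ι) : g →ₗ[K] g :=
  (p m).subtype ∘ₗ component K ι (fun i ↦ p i) m ∘ₗ (decomposeLinearEquiv p).toLinearMap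

/-- The degree-zero component of an endomorphism of a graded Lie algebra. -/
noncomputable def degreeZeroPart (π : g →ₗ[K] g) : g →ₗ[K] g :=
  toModule K ι g (fun m ↦ homogeneousPart p m ∘ₗ π ∘ₗ (p m).subtype) ∘ₗ
    (decomposeLinearEquiv p).toLinearMap

/-- A subspace is graded if it contains all homogeneous parts of its elements. -/
def IsGradedSubmodule (S : Submodule K g) : Prop :=
  ∀ x ∈ S, ∀ m, homogeneousPart p m x ∈ S

variable {p}

lemma homogeneousPart_mem (m : ι) (x : g) : homogeneousPart p m x ∈ p m :=
  (decompose p x m).2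

lemma homogeneousPart_of_mem {m : ι} {x : g} (hx : x ∈ p m) : homogeneousPart p m x = x :=
  decompose_of_mem_same p hx

lemma homogeneousPart_of_mem_ne {m n : ι} {x : g} (hx : x ∈ p m) (h : m ≠ n) :
    homogeneousPart p n x = 0 :=
  decompose_of_mem_ne p hx h

lemma degreeZeroPart_of_mem (π : g →ₗ[K] g) {m : ι} {x : g} (hx : x ∈ p m) :
    degreeZeroPart p π x = homogeneousPart p m (π x) := by
  rw [degreeZeroPart, LinearMap.comp_apply, LinearEquiv.coe_coe, decomposeLinearEquiv_apply,
    decompose_of_mem p hx]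
  exact toModule_lof (M := fun i ↦ p i) K m ⟨x, hx⟩

lemma IsGradedSubmodule.induction {S : Submodule K g} (hS : IsGradedSubmodule p S)
    {C : ∀ x, x ∈ S → Prop} (zero : C 0 S.zero_mem)
    (add : ∀ x y hx hy, C x hx → C y hy → C (x + y) (S.add_mem hx hy))
    (homogeneous : ∀ m, ∀ x ∈ p m, ∀ hx, C x hx) {x : g} (hx : x ∈ S) : C x hx := by
  classical
  have key : ∃ hx, C x hx := by
    rw [← sum_support_decompose p x]
    exact Finset.sum_induction _ (fun x ↦ ∃ hx, C x hx)
      (fun x y ⟨hx, hCx⟩ ⟨hy, hCy⟩ ↦ ⟨_, add x y hx hy hCx hCy⟩) ⟨_, zero⟩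
      fun m _ ↦ ⟨_, homogeneous m _ (homogeneousPart_mem m x) (hS x hx m)⟩
  exact key.2

lemma isGradedSubmodule_top : IsGradedSubmodule p ⊤ := fun _ _ _ ↦ Submodule.mem_top

lemma IsGradedSubmodule.eq_iSup {S : Submodule K g} (hS : IsGradedSubmodule p S) :
    S = ⨆ m, S ⊓ p m := by
  refine le_antisymm (fun x hx ↦ ?_) (iSup_le fun m ↦ inf_le_left)
  induction hx using hS.induction with
  | zero => exact zero_mem _
  | add x y _ _ hx hy => exact add_mem hx hy
  | homogeneous m x hm hx => exact Submodule.mem_iSup_of_mem m ⟨hx, hm⟩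

lemma homogeneousPart_degreeZeroPart (π : g →ₗ[K] g) (n : ι) (x : g) :
    homogeneousPart p n (degreeZeroPart p π x) = degreeZeroPart p π (homogeneousPart p n x) := by
  induction x using Decomposition.inductionOn p with
  | zero => simp
  | add x y hx hy => simp [hx, hy]
  | @homogeneous m x =>
    obtain ⟨x, hm⟩ := x
    rw [degreeZeroPart_of_mem π hm]
    by_cases h : m = n
    · subst h
      rw [homogeneousPart_of_mem hm, degreeZeroPart_of_mem π hm,
        homogeneousPart_of_mem (homogeneousPart_mem _ _)]
    · rw [homogeneousPart_of_mem_ne hm h, map_zero,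
        homogeneousPart_of_mem_ne (homogeneousPart_mem _ _) h]

variable [AddCommGroup ι]

lemma homogeneousPart_lie (hp : ∀ m n : ι, ∀ x ∈ p m, ∀ y ∈ p n, ⁅x, y⁆ ∈ p (m + n))
    {m n : ι} {x : g} (hx : x ∈ p m) (z : g) :
    homogeneousPart p (m + n) ⁅x, z⁆ = ⁅x, homogeneousPart p n z⁆ := by
  induction z using Decomposition.inductionOn p with
  | zero => simp
  | add y z hy hz => simp [hy, hz]
  | @homogeneous k z =>
    obtain ⟨z, hz⟩ := z
    by_cases h : k = n
    · subst h
      rw [homogeneousPart_of_mem hz, homogeneousPart_of_mem (hp m k x hx z hz)]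
    · rw [homogeneousPart_of_mem_ne hz h, lie_zero,
        homogeneousPart_of_mem_ne (hp m k x hx z hz) (by simpa using h)]

lemma IsGradedSubmodule.lie (hp : ∀ m n : ι, ∀ x ∈ p m, ∀ y ∈ p n, ⁅x, y⁆ ∈ p (m + n))
    {A B : LieIdeal K g} (hA : IsGradedSubmodule p A.toSubmodule)
    (hB : IsGradedSubmodule p B.toSubmodule) : IsGradedSubmodule p ⁅A, B⁆.toSubmodule := by
  intro x hx k
  rw [LieSubmodule.lieIdeal_oper_eq_linear_span'] at hx
  induction hx using Submodule.span_induction with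
  | zero => simp
  | add x y _ _ hx hy => rw [map_add]; exact add_mem hx hy
  | smul t x _ hx => rw [map_smul]; exact Submodule.smul_mem _ _ hx
  | mem x hx =>
  obtain ⟨a, ha, b, hb, rfl⟩ := hx
  refine hA.induction (C := fun a _ ↦ homogeneousPart p k ⁅a, b⁆ ∈ ⁅A, B⁆.toSubmodule) (by simp)
    (fun x y _ _ hx hy ↦ ?_) (fun m a ham ha ↦ ?_) ha
  · rw [add_lie, map_add]; exact add_mem hx hy
  refine hB.induction (C := fun b _ ↦ homogeneousPart p k ⁅a, b⁆ ∈ ⁅A, B⁆.toSubmodule) (by simp)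
    (fun x y _ _ hx hy ↦ ?_) (fun n b hbn hb ↦ ?_) hb
  · rw [lie_add, map_add]; exact add_mem hx hy
  have hab := hp m n a ham b hbn
  by_cases h : m + n = k
  · subst h
    rw [homogeneousPart_of_mem hab]
    exact LieSubmodule.lie_mem_lie ha hb
  · rw [homogeneousPart_of_mem_ne hab h]
    exact zero_mem _

lemma IsGradedSubmodule.derivedSeriesOfIdeal
    (hp : ∀ m n : ι, ∀ x ∈ p m, ∀ y ∈ p n, ⁅x, y⁆ ∈ p (m + n)) {A : LieIdeal K g}
    (hA : IsGradedSubmodule p A.toSubmodule) (k : ℕ) :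
    IsGradedSubmodule p (derivedSeriesOfIdeal K g k A).toSubmodule := by
  induction k with
  | zero => exact hA
  | succ k ih => rw [derivedSeriesOfIdeal_succ]; exact ih.lie hp ih

variable [CharZero K] [FiniteDimensional K g]

lemma exists_graded_subalgebra_inf_eq_lie
    (hp : ∀ m n : ι, ∀ x ∈ p m, ∀ y ∈ p n, ⁅x, y⁆ ∈ p (m + n))
    (R : LieIdeal K g) [IsKilling K (g ⧸ R)] (A : LieIdeal K g)
    (hAp : IsGradedSubmodule p A.toSubmodule) (h : LieSubalgebra K g)
    (hhp : IsGradedSubmodule p h.toSubmodule) (hA : ∀ x, x ∈ A ↔ x ∈ h ∧ x ∈ R)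
    (hR : ∀ x, ∃ y ∈ h, x - y ∈ R) :
    ∃ h' : LieSubalgebra K g, IsGradedSubmodule p h'.toSubmodule ∧
      (∀ x, x ∈ ⁅A, A⁆ ↔ x ∈ h' ∧ x ∈ R) ∧ ∀ x, ∃ y ∈ h', x - y ∈ R := by
  obtain ⟨π, hπA, hπ, hπ1⟩ := exists_projection_modulo_lie R A h hA hR
  have hA'p := hAp.lie hp hAp
  let ψ := degreeZeroPart p π
  have hψA (x) : ψ x ∈ A := by
    induction x using Decomposition.inductionOn p with
    | zero => simp
    | add y z hy hz => rw [map_add]; exact add_mem hy hz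
    | @homogeneous k z =>
      obtain ⟨z, hz⟩ := z
      rw [degreeZeroPart_of_mem π hz]
      exact hAp _ (hπA z) k
  have hψ1 (a) (ha : a ∈ A) : ψ a - a ∈ ⁅A, A⁆ := by
    induction ha using hAp.induction with
    | zero => simp
    | add y z _ _ hy hz => rw [map_add, add_sub_add_comm]; exact add_mem hy hz
    | homogeneous k z hz hzA =>
      have := hA'p _ (hπ1 z hzA) k
      rwa [map_sub, homogeneousPart_of_mem hz, ← degreeZeroPart_of_mem π hz] at this
  have hψ (x) (hx : x ∈ h) (y) (hy : y ∈ h) : ψ ⁅x, y⁆ - (⁅x, ψ y⁆ - ⁅y, ψ x⁆) ∈ ⁅A, A⁆ := by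
    refine hhp.induction (C := fun x _ ↦ ψ ⁅x, y⁆ - (⁅x, ψ y⁆ - ⁅y, ψ x⁆) ∈ ⁅A, A⁆) (by simp)
      (fun x y _ _ hx hy ↦ ?_) (fun m x hxm hx ↦ ?_) hx
    · convert add_mem hx hy using 1
      simp only [add_lie, lie_add, map_add]
      abel
    refine hhp.induction (C := fun y _ ↦ ψ ⁅x, y⁆ - (⁅x, ψ y⁆ - ⁅y, ψ x⁆) ∈ ⁅A, A⁆) (by simp)
      (fun x y _ _ hx hy ↦ ?_) (fun n y hyn hy ↦ ?_) hy
    · convert add_mem hx hy using 1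
      simp only [add_lie, lie_add, map_add]
      abel
    have := hA'p _ (hπ x hx y hy) (m + n)
    rw [map_sub, map_sub, homogeneousPart_lie hp hxm, add_comm m n, homogeneousPart_lie hp hyn,
      add_comm n m, ← degreeZeroPart_of_mem π hxm, ← degreeZeroPart_of_mem π hyn,
      ← degreeZeroPart_of_mem π (hp m n x hxm y hyn)] at this
    exact this
  have hA'A : ⁅A, A⁆ ≤ A := LieSubmodule.lie_le_right A A
  let h' : LieSubalgebra K g :=
    { h.toSubmodule ⊓ ⁅A, A⁆.toSubmodule.comap ψ with
      lie_mem' := by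
        rintro x y ⟨hx, hx'⟩ ⟨hy, hy'⟩
        refine ⟨h.lie_mem hx hy, ?_⟩
        have := add_mem (hψ x hx y hy) (sub_mem (lie_mem_right K g ⁅A, A⁆ x _ hy')
          (lie_mem_right K g ⁅A, A⁆ y _ hx'))
        rwa [sub_add_cancel] at this }
  have hh' (x) : x ∈ h' ↔ x ∈ h ∧ ψ x ∈ ⁅A, A⁆ := Iff.rfl
  refine ⟨h', fun x hx m ↦ ⟨hhp x hx.1 m, ?_⟩, fun x ↦ ⟨fun hx ↦ ?_, fun hx ↦ ?_⟩, fun x ↦ ?_⟩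
  · have := hA'p _ hx.2 m
    rwa [homogeneousPart_degreeZeroPart] at this
  · have hxA := hA'A hx
    refine ⟨⟨((hA x).1 hxA).1, ?_⟩, ((hA x).1 hxA).2⟩
    have := add_mem (hψ1 x hxA) hx
    rwa [sub_add_cancel] at this
  · have hxA := (hA x).2 ⟨hx.1.1, hx.2⟩
    have := sub_mem ((hh' x).1 hx.1).2 (hψ1 x hxA)
    rwa [sub_sub_cancel] at this
  · obtain ⟨y, hy, hxy⟩ := hR x
    refine ⟨y - ψ y, ⟨sub_mem hy ((hA _).1 (hψA y)).1, ?_⟩, ?_⟩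
    · have := neg_mem (hψ1 _ (hψA y))
      rwa [neg_sub, ← map_sub] at this
    · have := add_mem hxy ((hA _).1 (hψA y)).2
      rwa [sub_add] at this

end Graded

section Radical

open LieAlgebra DirectSum

lemma exists_injective_real_character (d : ℕ) : ∃ χ : (Fin d → ℤ) → ℝ,
    Function.Injective χ ∧ (∀ m n, χ (m + n) = χ m * χ n) ∧ ∀ m, χ m ≠ 0 := by
  obtain ⟨v, hv⟩ : ∃ v : Fin d → ℝ, LinearIndependent ℚ v := by
    have : (d : Cardinal) ≤ Module.rank ℚ ℝ := by
      rw [Real.rank_rat_real]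
      exact (Cardinal.natCast_lt_aleph0.trans Cardinal.aleph0_lt_continuum).le
    exact exists_linearIndependent_of_le_rank this
  refine ⟨fun m ↦ Real.exp (∑ i, m i * v i), fun m n h ↦ ?_, fun m n ↦ ?_,
    fun m ↦ Real.exp_ne_zero _⟩
  · have hv' := hv.restrict_scalars (R := ℤ) (by
      intro a b hab
      simpa using hab)
    have h1 := Real.exp_injective h
    rw [Fintype.linearIndependent_iff] at hv'
    ext i
    have := hv' (m - n) (by simpa [sub_mul, Finset.sum_sub_distrib, sub_eq_zero] using h1) i
    simpa [sub_eq_zero] using this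
  · simp [← Real.exp_add, add_mul, Finset.sum_add_distrib]

variable {K g ι : Type*} [Field K] [LieRing g] [LieAlgebra K g] [DecidableEq ι]
  [AddCommGroup ι] {p : ι → Submodule K g} [Decomposition p]

/-- A multiplicative character of the grading group acts on the Lie algebra by scaling
homogeneous components. -/
noncomputable def scalingHom (hp : ∀ m n : ι, ∀ x ∈ p m, ∀ y ∈ p n, ⁅x, y⁆ ∈ p (m + n)) (χ : ι → K)
    (hχ : ∀ m n, χ (m + n) = χ m * χ n) : g →ₗ⁅K⁆ g :=
  let f : g →ₗ[K] g := toModule K ι g (fun m ↦ χ m • (p m).subtype) ∘ₗ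
    (decomposeLinearEquiv p).toLinearMap
  have hf {m x} (hx : x ∈ p m) : f x = χ m • x := by
    change toModule K ι g (fun m ↦ χ m • (p m).subtype) (decompose p x) = _
    rw [decompose_of_mem p hx]
    exact toModule_lof (M := fun i ↦ p i) K m ⟨x, hx⟩
  { toLinearMap := f
    map_lie' := by
      intro x y
      change f ⁅x, y⁆ = ⁅f x, f y⁆
      induction x using Decomposition.inductionOn p with
      | zero => simp
      | add x z hx hz => simp [hx, hz]
      | @homogeneous m x =>
      induction y using Decomposition.inductionOn p with
      | zero => simp
      | add x z hx hz => simp [hx, hz]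
      | @homogeneous n y =>
      rw [hf x.2, hf y.2, hf (hp m n x x.2 y y.2), hχ]
      simp [mul_smul, smul_comm (χ n)] }

lemma scalingHom_of_mem (hp : ∀ m n : ι, ∀ x ∈ p m, ∀ y ∈ p n, ⁅x, y⁆ ∈ p (m + n)) (χ : ι → K)
    (hχ : ∀ m n, χ (m + n) = χ m * χ n) {m : ι} {x : g} (hx : x ∈ p m) :
    scalingHom hp χ hχ x = χ m • x := by
  change toModule K ι g (fun m ↦ χ m • (p m).subtype) (decompose p x) = _
  rw [decompose_of_mem p hx]
  exact toModule_lof (M := fun i ↦ p i) K m ⟨x, hx⟩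

lemma scalingHom_inv_apply (hp : ∀ m n : ι, ∀ x ∈ p m, ∀ y ∈ p n, ⁅x, y⁆ ∈ p (m + n)) (χ : ι → K)
    (hχ : ∀ m n, χ (m + n) = χ m * χ n) (hχ0 : ∀ m, χ m ≠ 0) (x : g) :
    scalingHom hp χ⁻¹ (fun m n ↦ by simp [hχ, mul_comm]) (scalingHom hp χ hχ x) = x := by
  induction x using Decomposition.inductionOn p with
  | zero => simp
  | add x z hx hz => simp [hx, hz]
  | @homogeneous m x =>
    rw [scalingHom_of_mem hp χ hχ x.2, map_smul, scalingHom_of_mem hp _ _ x.2, smul_smul]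
    simp [hχ0 m]

lemma comap_radical_le [FiniteDimensional K g] (f : g →ₗ⁅K⁆ g) (hf : Function.Injective f) :
    (radical K g).comap f ≤ radical K g := by
  rw [← LieIdeal.solvable_iff_le_radical]
  let e : (radical K g).comap f →ₗ⁅K⁆ radical K g :=
    { toFun x := ⟨f x, x.2⟩
      map_add' x y := by ext; simp
      map_smul' t x := by ext; simp
      map_lie' := by intros; ext; simp }
  refine Function.Injective.lieAlgebra_isSolvable (f := e) fun x y h ↦ ?_
  exact Subtype.ext (hf congr(($h : g)))

lemma isGradedSubmodule_radical [FiniteDimensional K g]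
    (hp : ∀ m n : ι, ∀ x ∈ p m, ∀ y ∈ p n, ⁅x, y⁆ ∈ p (m + n)) (χ : ι → K)
    (hχi : Function.Injective χ) (hχ : ∀ m n, χ (m + n) = χ m * χ n) (hχ0 : ∀ m, χ m ≠ 0) :
    IsGradedSubmodule p (radical K g).toSubmodule := by
  classical
  have hχ' : ∀ m n, χ⁻¹ (m + n) = χ⁻¹ m * χ⁻¹ n := fun m n ↦ by simp [hχ, mul_comm]
  have hinv (x) : scalingHom hp χ⁻¹ hχ' (scalingHom hp χ hχ x) = x :=
    scalingHom_inv_apply hp χ hχ hχ0 x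
  have hinv' (x) : scalingHom hp χ hχ (scalingHom hp χ⁻¹ hχ' x) = x := by
    have := scalingHom_inv_apply hp χ⁻¹ hχ' (by simpa using hχ0) x
    simpa only [inv_inv] using this
  have hstable (x) (hx : x ∈ radical K g) : scalingHom hp χ hχ x ∈ radical K g := by
    refine comap_radical_le (scalingHom hp χ⁻¹ hχ') (Function.LeftInverse.injective hinv') ?_
    rw [LieIdeal.mem_comap, hinv]
    exact hx
  have key (s : Finset ι) : ∀ y : ι → g, (∀ m, y m ∈ p m) → ∑ m ∈ s, y m ∈ radical K g →
      ∀ m ∈ s, y m ∈ radical K g := by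
    induction s using Finset.induction_on with
    | empty => simp
    | insert k s hk ih =>
      intro y hy hsum
      have hs : ∀ m ∈ s, y m ∈ radical K g := by
        intro m hm
        have h1 := sub_mem (hstable _ hsum)
          (Submodule.smul_mem (radical K g).toSubmodule (χ k) hsum)
        have h2 : scalingHom hp χ hχ (∑ m ∈ insert k s, y m) - χ k • ∑ m ∈ insert k s, y m =
            ∑ m ∈ s, (χ m - χ k) • y m := by
          simp only [Finset.sum_insert hk, map_add, map_sum, smul_add, Finset.smul_sum,
            scalingHom_of_mem hp χ hχ (hy _), sub_smul, Finset.sum_sub_distrib]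
          abel
        rw [h2] at h1
        have h3 := ih (fun m ↦ (χ m - χ k) • y m) (fun m ↦ Submodule.smul_mem _ _ (hy m)) h1 m hm
        refine (Submodule.smul_mem_iff (radical K g).toSubmodule ?_).1 h3
        rw [sub_ne_zero]
        exact fun h ↦ hk (hχi h ▸ hm)
      intro m hm
      rcases Finset.mem_insert.1 hm with rfl | hm
      · rw [Finset.sum_insert hk] at hsum
        exact (add_mem_cancel_right (sum_mem hs)).1 hsum
      · exact hs m hm
  intro x hx m
  rw [← sum_support_decompose p x] at hx
  by_cases hm : m ∈ (decompose p x).support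
  · exact key _ (fun m ↦ homogeneousPart p m x) (fun m ↦ homogeneousPart_mem m x) hx m hm
  · have : homogeneousPart p m x = 0 := by
      rw [DFinsupp.notMem_support_iff] at hm
      exact congr(($hm : g))
    rw [this]
    exact zero_mem _

end Radical

section Levi

open LieAlgebra DirectSum

variable {K g : Type*} [Field K] [LieRing g] [LieAlgebra K g] [FiniteDimensional K g]

lemma hasTrivialRadical_quotient_radical : HasTrivialRadical K (g ⧸ radical K g) := by
  refine hasTrivialRadical_of_no_solvable_ideals fun I hI ↦ ?_
  let q : g →ₗ⁅K⁆ g ⧸ radical K g :=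
    { toLinearMap := (LieSubmodule.Quotient.mk' (radical K g) : g →ₗ[K] g ⧸ radical K g)
      map_lie' := rfl }
  have hq0 (x) : q x = 0 ↔ x ∈ radical K g := LieSubmodule.Quotient.mk_eq_zero _
  have hmap (k) :
      (derivedSeriesOfIdeal K g k (I.comap q)).map q ≤ derivedSeriesOfIdeal K _ k I := by
    induction k with
    | zero => exact LieIdeal.map_comap_le
    | succ k ih =>
      rw [derivedSeriesOfIdeal_succ, derivedSeriesOfIdeal_succ]
      exact (LieIdeal.map_bracket_le q).trans (LieSubmodule.mono_lie ih ih)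
  have hJ : IsSolvable (I.comap q) := by
    obtain ⟨k, hk⟩ := (isSolvable_iff K (L := I)).1 hI
    obtain ⟨l, hl⟩ := (isSolvable_iff K (L := radical K g)).1 inferInstance
    rw [LieIdeal.derivedSeries_eq_bot_iff] at hk hl
    rw [isSolvable_iff K]
    refine ⟨l + k, ?_⟩
    rw [LieIdeal.derivedSeries_eq_bot_iff, derivedSeriesOfIdeal_add, eq_bot_iff, ← hl]
    refine derivedSeriesOfIdeal_mono (fun x hx ↦ ?_) l
    rw [← hq0, ← LieSubmodule.mem_bot (R := K) (L := g ⧸ radical K g), ← hk]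
    exact hmap k (LieIdeal.mem_map hx)
  rw [LieIdeal.solvable_iff_le_radical] at hJ
  rw [eq_bot_iff]
  intro z hz
  obtain ⟨x, rfl⟩ := LieSubmodule.Quotient.surjective_mk' _ z
  exact (hq0 x).2 (hJ hz)

variable [CharZero K] {ι : Type*} [DecidableEq ι] [AddCommGroup ι] {p : ι → Submodule K g}
  [Decomposition p]

lemma exists_graded_subalgebra_inf_eq_derivedSeriesOfIdeal
    (hp : ∀ m n : ι, ∀ x ∈ p m, ∀ y ∈ p n, ⁅x, y⁆ ∈ p (m + n))
    (R : LieIdeal K g) [IsKilling K (g ⧸ R)] (hR : IsGradedSubmodule p R.toSubmodule) (k : ℕ) :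
    ∃ h : LieSubalgebra K g, IsGradedSubmodule p h.toSubmodule ∧
      (∀ x, x ∈ derivedSeriesOfIdeal K g k R ↔ x ∈ h ∧ x ∈ R) ∧ ∀ x, ∃ y ∈ h, x - y ∈ R := by
  induction k with
  | zero =>
    exact ⟨⊤, isGradedSubmodule_top, fun x ↦ by simp, fun x ↦ ⟨x, by simp, by simp⟩⟩
  | succ k ih =>
    obtain ⟨h, hh, hA, hsup⟩ := ih
    rw [derivedSeriesOfIdeal_succ]
    exact exists_graded_subalgebra_inf_eq_lie hp R _ (hR.derivedSeriesOfIdeal hp k) h hh hA hsup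

lemma isSemisimple_of_isCompl_radical (l : LieSubalgebra K g)
    (hl : IsCompl l.toSubmodule (radical K g).toSubmodule) : IsSemisimple K l := by
  have := hasTrivialRadical_quotient_radical (K := K) (g := g)
  let q : l →ₗ⁅K⁆ g ⧸ radical K g :=
    { toLinearMap := (LieSubmodule.Quotient.mk' (radical K g) : g →ₗ[K] g ⧸ radical K g) ∘ₗ
        l.toSubmodule.subtype
      map_lie' := rfl }
  let e : l ≃ₗ[K] g ⧸ radical K g :=
    (Submodule.quotientEquivOfIsCompl _ _ hl.symm).symm
  have he (x : l) : e x = q x := by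
    rw [LinearEquiv.symm_apply_eq]
    exact (Submodule.quotientEquivOfIsCompl_apply_mk_right hl.symm x).symm
  have e' : (g ⧸ radical K g) ≃ₗ⁅K⁆ l := (LieEquiv.ofBijective q (by
    have : (q : l → g ⧸ radical K g) = e := funext fun x ↦ (he x).symm
    rw [this]
    exact e.bijective)).symm
  have : IsKilling K l := e'.isKilling
  infer_instance

/-- A graded form of Levi's theorem. -/
lemma exists_graded_isCompl_radical
    (hp : ∀ m n : ι, ∀ x ∈ p m, ∀ y ∈ p n, ⁅x, y⁆ ∈ p (m + n))
    (hR : IsGradedSubmodule p (radical K g).toSubmodule) :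
    ∃ l : LieSubalgebra K g, IsGradedSubmodule p l.toSubmodule ∧
      IsCompl l.toSubmodule (radical K g).toSubmodule := by
  have := hasTrivialRadical_quotient_radical (K := K) (g := g)
  obtain ⟨k, hk⟩ := (isSolvable_iff K (L := radical K g)).1 inferInstance
  rw [LieIdeal.derivedSeries_eq_bot_iff] at hk
  obtain ⟨l, hl, hinf, hsup⟩ :=
    exists_graded_subalgebra_inf_eq_derivedSeriesOfIdeal hp (radical K g) hR k
  refine ⟨l, hl, ?_⟩
  rw [hk] at hinf
  rw [isCompl_iff, Submodule.disjoint_def, codisjoint_iff_le_sup]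
  refine ⟨fun x hx hx' ↦ (hinf x).2 ⟨hx, hx'⟩, fun x _ ↦ ?_⟩
  obtain ⟨y, hy, hxy⟩ := hsup x
  exact Submodule.mem_sup.2 ⟨y, hy, _, hxy, add_sub_cancel y x⟩

end Levi

/-- If `g` is a finite-dimensional real Lie algebra graded over `ℤ^d`, then the radical is
the sum of its intersections with the graded pieces, and there is a Levi subalgebra that is
likewise the sum of its intersections with the graded pieces. -/
theorem radical_and_levi_graded_of_zd_grading
    (g : Type*) [LieRing g] [LieAlgebra ℝ g] [FiniteDimensional ℝ g]
    (d : ℕ) (p : (Fin d → ℤ) → Submodule ℝ g)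
    (hinternal : DirectSum.IsInternal p)
    (hbracket : ∀ m n : Fin d → ℤ, ∀ x ∈ p m, ∀ y ∈ p n, ⁅x, y⁆ ∈ p (m + n)) :
    ((LieAlgebra.radical ℝ g).toSubmodule
        = ⨆ m : Fin d → ℤ, (LieAlgebra.radical ℝ g).toSubmodule ⊓ p m) ∧
      ∃ l : LieSubalgebra ℝ g, IsLeviSubalgebra g l ∧
        l.toSubmodule = ⨆ m : Fin d → ℤ, l.toSubmodule ⊓ p m := by
  let _ := hinternal.chooseDecomposition
  obtain ⟨χ, hχi, hχ, hχ0⟩ := exists_injective_real_character d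
  have hR := isGradedSubmodule_radical hbracket χ hχi hχ hχ0
  obtain ⟨l, hl, hlR⟩ := exists_graded_isCompl_radical hbracket hR
  exact ⟨hR.eq_iSup, l, ⟨isSemisimple_of_isCompl_radical l hlR, hlR⟩, hl.eq_iSup⟩
end

section
/- Let g be a finite-dimensional real Lie algebra with radical r, let S be a family of pairwise commuting semisimple derivations of g, and let l be a Levi subalgebra of g such that δ(l) ⊆ l and δ(r) ⊆ r for all δ ∈ S. Then for each δ ∈ S there exist an element B_δ ∈ l and a derivation D_δ of g such that: δ = ad(B_δ) + D_δ; the elements B_δ (δ ∈ S) pairwise commute in l (so they span a commutative subalgebra b of l); D_δ(x) = 0 for every x ∈ l; and the derivations ad(B_δ) and D_{δ'} (δ, δ' ∈ S) all pairwise commute. -/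
/-- A derivation preserving a Lie subalgebra `l` restricts to a derivation of `l`. -/
def LieDerivation.restrictSubalgebra {R L : Type*} [CommRing R] [LieRing L] [LieAlgebra R L]
    (l : LieSubalgebra R L) (δ : LieDerivation R L L) (h : ∀ x ∈ l, δ x ∈ l) :
    LieDerivation R l l where
  toLinearMap := δ.toLinearMap.restrict h
  leibniz' a b := Subtype.ext (δ.leibniz' a b)

/-- A derivation preserving a Killing subalgebra `l` agrees on `l` with the inner derivation of an
element of `l`. -/
lemma LieDerivation.exists_mem_forall_lie_eq {K L : Type*} [Field K] [LieRing L] [LieAlgebra K L]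
    (l : LieSubalgebra K L) [Module.Finite K l] [LieAlgebra.IsKilling K l]
    (δ : LieDerivation K L L) (h : ∀ x ∈ l, δ x ∈ l) :
    ∃ b ∈ l, ∀ x ∈ l, ⁅b, x⁆ = δ x := by
  obtain ⟨b, hb⟩ := LieDerivation.IsKilling.exists_eq_ad (δ.restrictSubalgebra l h)
  refine ⟨b, b.2, fun x hx ↦ ?_⟩
  have hx' := DFunLike.congr_fun hb ⟨x, hx⟩
  rw [LieDerivation.ad_apply_apply] at hx'
  exact congrArg Subtype.val hx'

/-- An element of a Killing subalgebra `l` that centralizes `l` vanishes. -/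
lemma LieSubalgebra.eq_zero_of_forall_lie_eq_zero {K L : Type*} [Field K] [LieRing L]
    [LieAlgebra K L] (l : LieSubalgebra K L) [Module.Finite K l] [LieAlgebra.IsKilling K l]
    {b : L} (hb : b ∈ l) (h : ∀ x ∈ l, ⁅b, x⁆ = 0) : b = 0 :=
  congrArg Subtype.val ((LieDerivation.IsKilling.ad_apply_eq_zero_iff K l ⟨b, hb⟩).mp
    (LieDerivation.ext fun x ↦ Subtype.ext (by simpa using h x x.2)))

/-- A derivation commutes with the inner derivations of the elements it kills. -/
lemma LieDerivation.commute_ad_of_apply_eq_zero {R L : Type*} [CommRing R] [LieRing L]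
    [LieAlgebra R L] (D : LieDerivation R L L) {b : L} (h : D b = 0) :
    Commute ((LieDerivation.ad R L b).toLinearMap : Module.End R L) D.toLinearMap := by
  ext x
  simp [h]

/-- Given a family `S` of pairwise commuting semisimple derivations of `g` preserving a Levi
subalgebra `l` and the radical `r`, each `δ ∈ S` splits as `ad(B_δ) + D_δ` with `B_δ ∈ l`,
the `B_δ` pairwise commuting, `D_δ` vanishing on `l`, and all the derivations `ad(B_δ)`,
`D_δ'` pairwise commuting. -/
theorem derivations_split_along_invariant_levi
    (g : Type*) [LieRing g] [LieAlgebra ℝ g] [FiniteDimensional ℝ g]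
    (S : Set (LieDerivation ℝ g g))
    (hcomm : ∀ δ ∈ S, ∀ δ' ∈ S, Commute (δ.toLinearMap : Module.End ℝ g)
      (δ'.toLinearMap : Module.End ℝ g))
    (hss : ∀ δ ∈ S, Module.End.IsSemisimple (δ.toLinearMap : Module.End ℝ g))
    (l : LieSubalgebra ℝ g) (hl : IsLeviSubalgebra g l)
    (hlinv : ∀ δ ∈ S, ∀ x ∈ l, δ x ∈ l)
    (hrinv : ∀ δ ∈ S, ∀ x ∈ LieAlgebra.radical ℝ g, δ x ∈ LieAlgebra.radical ℝ g) :
    ∃ (B : S → g) (D : S → LieDerivation ℝ g g),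
      (∀ δ : S, B δ ∈ l) ∧
      (∀ δ : S, (δ : LieDerivation ℝ g g) = LieDerivation.ad ℝ g (B δ) + D δ) ∧
      (∀ δ δ' : S, ⁅B δ, B δ'⁆ = 0) ∧
      (∀ δ : S, ∀ x ∈ l, D δ x = 0) ∧
      (∀ δ δ' : S, Commute ((LieDerivation.ad ℝ g (B δ)).toLinearMap : Module.End ℝ g)
        ((LieDerivation.ad ℝ g (B δ')).toLinearMap : Module.End ℝ g)) ∧
      (∀ δ δ' : S, Commute ((LieDerivation.ad ℝ g (B δ)).toLinearMap : Module.End ℝ g)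
        ((D δ').toLinearMap : Module.End ℝ g)) ∧
      (∀ δ δ' : S, Commute ((D δ).toLinearMap : Module.End ℝ g)
        ((D δ').toLinearMap : Module.End ℝ g)) := by
  have := hl.1
  choose B hB hBδ using fun δ : S ↦ LieDerivation.exists_mem_forall_lie_eq l δ (hlinv δ δ.2)
  have hδδ (δ δ' : S) (x : g) : (δ : LieDerivation ℝ g g) ((δ' : LieDerivation ℝ g g) x) =
      (δ' : LieDerivation ℝ g g) ((δ : LieDerivation ℝ g g) x) :=
    LinearMap.congr_fun (hcomm δ δ.2 δ' δ'.2) x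
  have hBB (δ δ' : S) : ⁅B δ, B δ'⁆ = 0 := by
    refine l.eq_zero_of_forall_lie_eq_zero (l.lie_mem (hB δ) (hB δ')) fun x hx ↦ ?_
    rw [lie_lie, hBδ δ' x hx, hBδ δ x hx, hBδ δ _ (hlinv δ' δ'.2 x hx),
      hBδ δ' _ (hlinv δ δ.2 x hx), hδδ, sub_self]
  let D (δ : S) : LieDerivation ℝ g g := δ - LieDerivation.ad ℝ g (B δ)
  have hD (δ : S) (x : g) (hx : x ∈ l) : D δ x = 0 := by simp [D, hBδ δ x hx]
  have hadD (δ δ' : S) := (D δ').commute_ad_of_apply_eq_zero (hD δ' (B δ) (hB δ))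
  have hadad (δ δ' : S) := (LieDerivation.ad ℝ g (B δ')).commute_ad_of_apply_eq_zero
    (b := B δ) (by simp [hBB])
  refine ⟨B, D, hB, fun δ ↦ (add_sub_cancel _ _).symm, hBB, hD, hadad, hadD, fun δ δ' ↦ ?_⟩
  have hadδ : Commute (LieDerivation.ad ℝ g (B δ')).toLinearMap
      (δ : LieDerivation ℝ g g).toLinearMap := by
    have h := (hadad δ' δ).add_right (hadD δ' δ)
    rwa [← LieDerivation.coe_add_linearMap, add_sub_cancel] at h
  have h := ((hcomm δ δ.2 δ' δ'.2).sub_right hadδ.symm).sub_left (hadD δ δ')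
  exact h
end

section
/- Let g be a finite-dimensional real Lie algebra with radical r such that ⁅g, r⁆ = r, ⁅r, r⁆ = {0}, and the centre of g is trivial. Let l be a Levi subalgebra of g and let H ∈ g be such that ad(H) is a semisimple linear endomorphism of g. Then there exists X ∈ r such that the subspace l̃ = { y + ⁅X, y⁆ : y ∈ l } (the image of l under the automorphism exp(ad(X)) = id + ad(X), which is well defined since (ad X)² = 0) is a Levi subalgebra of g containing H. -/
open Polynomial in
/-- If `f` is semisimple and preserves `q`, and `g` preserves a complement `p` of `q`, agrees with
`f` on `q` and induces the same map as `f` modulo `q`, then `g` is semisimple. -/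
lemma Module.End.IsSemisimple.of_isCompl_of_sub_mem {K M : Type*} [Field K] [AddCommGroup M]
    [Module K M] [FiniteDimensional K M] {f g : Module.End K M} (hf : f.IsSemisimple)
    {p q : Submodule K M} (hpq : IsCompl p q) (hgp : ∀ x ∈ p, g x ∈ p)
    (hfq : ∀ x ∈ q, f x ∈ q) (hgq : ∀ x ∈ q, g x = f x) (hsub : ∀ x, g x - f x ∈ q) :
    g.IsSemisimple := by
  have pow_p (n : ℕ) : ∀ x ∈ p, (g ^ n) x ∈ p := by
    induction n with
    | zero => intro x hx; simpa using hx
    | succ n ih => intro x hx; rw [pow_succ]; exact ih _ (hgp x hx)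
  have pow_q (n : ℕ) : ∀ x ∈ q, (f ^ n) x ∈ q ∧ (g ^ n) x = (f ^ n) x := by
    induction n with
    | zero => intro x hx; simpa using hx
    | succ n ih =>
      intro x hx
      rw [pow_succ, pow_succ, Module.End.mul_apply, Module.End.mul_apply, hgq x hx]
      exact ih _ (hfq x hx)
  have pow_sub (n : ℕ) : ∀ x, (g ^ n) x - (f ^ n) x ∈ q := by
    induction n with
    | zero => intro x; simp
    | succ n ih =>
      intro x
      rw [pow_succ, pow_succ, Module.End.mul_apply, Module.End.mul_apply]
      have h := q.add_mem (ih (g x)) (pow_q n _ (hsub x)).1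
      rwa [map_sub, sub_add_sub_cancel] at h
  have aeval_p (P : K[X]) (x : M) (hx : x ∈ p) : aeval g P x ∈ p := by
    rw [aeval_eq_sum_range, LinearMap.sum_apply]
    exact p.sum_mem fun i _ ↦ p.smul_mem _ (pow_p i x hx)
  have aeval_q (P : K[X]) (x : M) (hx : x ∈ q) : aeval g P x = aeval f P x := by
    rw [aeval_eq_sum_range, aeval_eq_sum_range, LinearMap.sum_apply, LinearMap.sum_apply]
    exact Finset.sum_congr rfl fun i _ ↦ by simp [(pow_q i x hx).2]
  have aeval_sub (P : K[X]) (x : M) : aeval g P x - aeval f P x ∈ q := by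
    rw [aeval_eq_sum_range, aeval_eq_sum_range, LinearMap.sum_apply, LinearMap.sum_apply,
      ← Finset.sum_sub_distrib]
    refine q.sum_mem fun i _ ↦ ?_
    rw [LinearMap.smul_apply, LinearMap.smul_apply, ← smul_sub]
    exact q.smul_mem _ (pow_sub i x)
  refine isSemisimple_of_squarefree_aeval_eq_zero hf.minpoly_squarefree ?_
  ext x
  obtain ⟨y, z, hy, hz, rfl⟩ := Submodule.codisjoint_iff_exists_add_eq.mp hpq.codisjoint x
  have h1 := aeval_sub (minpoly K f) y
  rw [minpoly.aeval, LinearMap.zero_apply, sub_zero] at h1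
  rw [map_add, aeval_q _ z hz, minpoly.aeval,
    Submodule.disjoint_def.mp hpq.disjoint _ (aeval_p _ y hy) h1]
  simp

/-- The image of a semisimple endomorphism `f` is contained in the image of `f ∘ f`. -/
lemma Module.End.IsSemisimple.exists_apply_apply_eq {R M : Type*} [CommRing R] [AddCommGroup M]
    [Module R M] {f : Module.End R M} (hf : f.IsSemisimple) (x : M) : ∃ y, f (f y) = f x := by
  obtain ⟨q, hq, hc⟩ := isSemisimple_iff.mp hf (LinearMap.range f)
    ((mem_invtSubmodule f).mpr fun y _ ↦ ⟨y, rfl⟩)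
  obtain ⟨_, z, ⟨y, rfl⟩, hz, rfl⟩ := Submodule.codisjoint_iff_exists_add_eq.mp hc.codisjoint x
  have : f z = 0 := Submodule.disjoint_def.mp hc.disjoint _ ⟨z, rfl⟩ (hq hz)
  exact ⟨y, by rw [map_add, this, add_zero]⟩

/-- For `X` in an abelian ideal `I`, the map `exp (ad X) = id + ad X` as a Lie algebra
automorphism. -/
noncomputable def LieIdeal.oneAddAd {R L : Type*} [CommRing R] [LieRing L] [LieAlgebra R L]
    (I : LieIdeal R L) (hI : ∀ x ∈ I, ∀ y ∈ I, ⁅x, y⁆ = 0) (X : L) (hX : X ∈ I) : L ≃ₗ⁅R⁆ L where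
  toLinearMap := LinearMap.id + LieAlgebra.ad R L X
  map_lie' {x y} := by
    have h := hI _ (lie_mem_left R L I X x hX) _ (lie_mem_left R L I X y hX)
    simp [h]
    abel
  invFun y := y - ⁅X, y⁆
  left_inv x := by
    have h := hI _ hX _ (lie_mem_left R L I X x hX)
    simp [h]
  right_inv x := by
    have h := hI _ hX _ (lie_mem_left R L I X x hX)
    simp [h]

lemma LieIdeal.oneAddAd_apply {R L : Type*} [CommRing R] [LieRing L] [LieAlgebra R L]
    (I : LieIdeal R L) (hI : ∀ x ∈ I, ∀ y ∈ I, ⁅x, y⁆ = 0) (X : L) (hX : X ∈ I) (y : L) :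
    I.oneAddAd hI X hX y = y + ⁅X, y⁆ := rfl

/-- The image of a Levi subalgebra under an automorphism fixing the radical pointwise is a Levi
subalgebra. -/
lemma IsLeviSubalgebra.map {g : Type*} [LieRing g] [LieAlgebra ℝ g] [FiniteDimensional ℝ g]
    {l : LieSubalgebra ℝ g} (hl : IsLeviSubalgebra g l) (e : g ≃ₗ⁅ℝ⁆ g)
    (he : ∀ x ∈ LieAlgebra.radical ℝ g, e x = x) :
    IsLeviSubalgebra g (l.map (e : g →ₗ⁅ℝ⁆ g)) := by
  constructor
  · have := hl.1
    have : LieAlgebra.IsKilling ℝ (l.map (e : g →ₗ⁅ℝ⁆ g)) :=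
      LieAlgebra.isKilling_of_equiv (e.lieSubalgebraMap l)
    infer_instance
  · have hr : (LieAlgebra.radical ℝ g).toSubmodule.map e.toLinearEquiv.toLinearMap =
        (LieAlgebra.radical ℝ g).toSubmodule := by
      ext x
      constructor
      · rintro ⟨y, hy, rfl⟩
        simpa [he y hy] using hy
      · intro hx
        exact ⟨x, hx, he x hx⟩
    rw [← hr]
    exact (Submodule.orderIsoMapComap e.toLinearEquiv).isCompl hl.2

/-- Let `I` be an abelian ideal of a Lie algebra with trivial centre. If `H = L + N` with
`ad L`, `ad H` semisimple, `N ∈ I` and `L`, `N` commuting, then `N = 0`. -/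
lemma LieIdeal.eq_zero_of_isSemisimple_ad_add {K g : Type*} [Field K] [PerfectField K] [LieRing g]
    [LieAlgebra K g] [FiniteDimensional K g] (hcenter : LieAlgebra.center K g = ⊥)
    (I : LieIdeal K g) (hI : ∀ x ∈ I, ∀ y ∈ I, ⁅x, y⁆ = 0) {L N : g} (hN : N ∈ I)
    (hLN : ⁅L, N⁆ = 0) (hL : (LieAlgebra.ad K g L).IsSemisimple)
    (hH : (LieAlgebra.ad K g (L + N)).IsSemisimple) : N = 0 := by
  have hcomm : Commute (LieAlgebra.ad K g (L + N)) (LieAlgebra.ad K g L) := by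
    ext x
    simp only [Module.End.mul_apply, LieAlgebra.ad_apply, add_lie, lie_add]
    rw [leibniz_lie L N x, hLN, zero_lie, zero_add]
  have hss := hH.sub_of_commute hcomm hL
  rw [map_add, add_sub_cancel_left] at hss
  have hnil : IsNilpotent (LieAlgebra.ad K g N) := ⟨2, by
    ext x
    simpa [pow_two] using hI _ hN _ (lie_mem_left K g I N x hN)⟩
  have h0 := Module.End.eq_zero_of_isNilpotent_isSemisimple hnil hss
  have : N ∈ LieAlgebra.center K g := by
    rw [LieModule.mem_maxTrivSubmodule]
    intro x
    rw [← lie_skew, ← LieAlgebra.ad_apply K, h0]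
    simp
  simpa [hcenter] using this


/-- Suppose `⁅g, r⁆ = r`, `⁅r, r⁆ = 0` and the centre of `g` is trivial. If `l` is a Levi
subalgebra and `ad H` is semisimple, then for some `X ∈ r` the image
`l̃ = {y + ⁅X, y⁆ : y ∈ l}` of `l` under `exp(ad X) = id + ad X` is a Levi subalgebra
containing `H`. -/
theorem exists_conjugate_levi_containing_semisimple_element
    (g : Type*) [LieRing g] [LieAlgebra ℝ g] [FiniteDimensional ℝ g]
    (hgr : (⁅(⊤ : LieIdeal ℝ g), LieAlgebra.radical ℝ g⁆ : LieIdeal ℝ g)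
      = LieAlgebra.radical ℝ g)
    (hrr : ∀ x ∈ LieAlgebra.radical ℝ g, ∀ y ∈ LieAlgebra.radical ℝ g, ⁅x, y⁆ = 0)
    (hcenter : LieAlgebra.center ℝ g = ⊥)
    (l : LieSubalgebra ℝ g) (hl : IsLeviSubalgebra g l)
    (H : g) (hss : Module.End.IsSemisimple (LieAlgebra.ad ℝ g H)) :
    ∃ X ∈ LieAlgebra.radical ℝ g, ∃ l' : LieSubalgebra ℝ g,
      l'.toSubmodule
        = Submodule.map (LinearMap.id + LieAlgebra.ad ℝ g X) l.toSubmodule ∧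
      IsLeviSubalgebra g l' ∧ H ∈ l' := by
  set r := LieAlgebra.radical ℝ g with hr
  obtain ⟨L, R, hL, hR, rfl⟩ := Submodule.codisjoint_iff_exists_add_eq.mp hl.2.codisjoint H
  have hlie (x y : g) (hy : y ∈ r) : ⁅x, y⁆ ∈ r := lie_mem_right ℝ g r x y hy
  have hLss : (LieAlgebra.ad ℝ g L).IsSemisimple := by
    refine hss.of_isCompl_of_sub_mem hl.2 (fun x hx ↦ l.lie_mem hL hx)
      (fun x hx ↦ hlie _ x hx) (fun x hx ↦ ?_) (fun x ↦ ?_)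
    · simp [hrr R hR x hx]
    · rw [map_add, LinearMap.add_apply, sub_add_cancel_left]
      exact r.neg_mem (lie_mem_left ℝ g r R x hR)
  obtain ⟨y, hy⟩ := hLss.exists_apply_apply_eq R
  obtain ⟨y', Z, hy', hZ, rfl⟩ := Submodule.codisjoint_iff_exists_add_eq.mp hl.2.codisjoint y
  simp only [LieAlgebra.ad_apply, lie_add] at hy
  have hy0 : ⁅L, ⁅L, y'⁆⁆ = 0 := by
    refine Submodule.disjoint_def.mp hl.2.disjoint _ (l.lie_mem hL (l.lie_mem hL hy')) ?_
    rw [eq_sub_of_add_eq hy]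
    exact r.sub_mem (hlie _ _ hR) (hlie _ _ (hlie _ _ hZ))
  rw [hy0, zero_add] at hy
  have hN : R - ⁅L, Z⁆ = 0 := by
    refine r.eq_zero_of_isSemisimple_ad_add hcenter hrr (L := L)
      (r.sub_mem hR (hlie _ _ hZ)) (by rw [lie_sub, hy, sub_self]) hLss ?_
    have he : r.oneAddAd hrr Z hZ (L + R) = L + (R - ⁅L, Z⁆) := by
      rw [LieIdeal.oneAddAd_apply, lie_add, hrr Z hZ R hR, ← lie_skew]
      abel
    rw [← he]
    refine (LinearEquiv.isSemisimple_iff _ _ (r.oneAddAd hrr Z hZ).toLinearEquiv ?_).mp hss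
    ext x
    exact (r.oneAddAd hrr Z hZ).map_lie _ _
  have hX : -Z ∈ r := r.neg_mem hZ
  refine ⟨-Z, hX, l.map (r.oneAddAd hrr (-Z) hX : g →ₗ⁅ℝ⁆ g), rfl,
    hl.map _ fun x hx ↦ ?_, ⟨L, hL, ?_⟩⟩
  · rw [LieIdeal.oneAddAd_apply, hrr _ hX x hx, add_zero]
  · change L + ⁅-Z, L⁆ = L + R
    rw [neg_lie, lie_skew, sub_eq_zero.mp hN]
end
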